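/- arXiv:1303.3793 — 5 statements merged into one kernel-verified Lean document; each statement's English description precedes it below -/
import Mathlib

section
/- There exist a real constant b > 0 and a real x₀ > 0 such that for every real x ≥ x₀, the number of distinct non-trivial Ramsey numbers in [0,x] satisfies r(x) ≤ b·√(x·ln x). -/
open SimpleGraph Finset Real

/-- `ramsey k n` is the least positive integer `N` such that every red/blue coloring of the
edges of the complete graph on `N` vertices (encoded as a simple graph `G` on `Fin N`,
with red edges the edges of `G` and blue edges those of `Gᶜ`) contains a red clique on
`k` vertices or a blue clique on `n` vertices. -/
noncomputable def ramsey (k n : ℕ) : ℕ :=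
  sInf {N : ℕ | 0 < N ∧ ∀ G : SimpleGraph (Fin N),
    (∃ s : Finset (Fin N), G.IsNClique k s) ∨ (∃ s : Finset (Fin N), Gᶜ.IsNClique n s)}

/-- The set `R(x)` of non-trivial Ramsey numbers at most `x`. -/
def RamseySet (x : ℝ) : Set ℕ :=
  {m : ℕ | (∃ k n : ℕ, 3 ≤ k ∧ k ≤ n ∧ ramsey k n = m) ∧ (m : ℝ) ≤ x}

/-- `r(x)`: the number of distinct non-trivial Ramsey numbers in `[0, x]`. -/
noncomputable def ramseyCount (x : ℝ) : ℕ := (RamseySet x).ncard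

/-- The set `R_k(x) = {r(k,n) : n ≥ k} ∩ [0,x]`. -/
def RamseySetRow (k : ℕ) (x : ℝ) : Set ℕ :=
  {m : ℕ | (∃ n : ℕ, k ≤ n ∧ ramsey k n = m) ∧ (m : ℝ) ≤ x}

/-- `r_k(x)`: the number of distinct values `r(k,n)` (`n ≥ k`) in `[0, x]`. -/
noncomputable def ramseyCountRow (k : ℕ) (x : ℝ) : ℕ := (RamseySetRow k x).ncard

/-! ### Uniform probability on a finite sample space -/

open Classical in
/-- The probability of `P` under the uniform distribution on `Ω`. -/
noncomputable def prob {Ω : Type*} [Fintype Ω] (P : Ω → Prop) : ℝ :=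
  (#{ω | P ω} : ℝ) / Fintype.card Ω

section Prob

variable {Ω : Type*} [Fintype Ω]

theorem prob_mono {P Q : Ω → Prop} (h : ∀ ω, P ω → Q ω) : prob P ≤ prob Q := by
  classical
  unfold prob
  gcongr with ω
  exact h ω

theorem prob_exists_le {ι : Type*} (I : Finset ι) (P : ι → Ω → Prop) :
    prob (fun ω => ∃ i ∈ I, P i ω) ≤ ∑ i ∈ I, prob (P i) := by
  classical
  unfold prob
  rw [← Finset.sum_div]
  gcongr
  have : (({ω | ∃ i ∈ I, P i ω} : Finset Ω)) ⊆ I.biUnion fun i => ({ω | P i ω} : Finset Ω) := by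
    intro ω; simp
  have h2 := (Nat.cast_le (α := ℝ)).2 ((Finset.card_le_card this).trans Finset.card_biUnion_le)
  push_cast at h2
  convert h2
  rfl

theorem prob_exists_le_card_mul {ι : Type*} {I : Finset ι} {P : ι → Ω → Prop} {c : ℝ}
    (h : ∀ i ∈ I, prob (P i) ≤ c) : prob (fun ω => ∃ i ∈ I, P i ω) ≤ #I * c := by
  refine (prob_exists_le I P).trans ?_
  simpa using Finset.sum_le_card_nsmul I _ c h

theorem prob_or_le (P Q : Ω → Prop) : prob (fun ω => P ω ∨ Q ω) ≤ prob P + prob Q := by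
  have := prob_exists_le (univ : Finset Bool) (fun i => cond i P Q)
  simpa [or_comm, add_comm] using this

theorem exists_not_of_prob_lt_one [Nonempty Ω] {P : Ω → Prop} (h : prob P < 1) : ∃ ω, ¬ P ω := by
  classical
  by_contra! hP
  unfold prob at h
  simp [hP] at h

theorem card_filter_eq_prob_mul [Nonempty Ω] (P : Ω → Prop) [DecidablePred P] :
    (#{ω | P ω} : ℝ) = prob P * Fintype.card Ω := by
  unfold prob
  have : (Fintype.card Ω : ℝ) ≠ 0 := by simp
  field_simp
  congr!

/-- If bad events of two independent variables, and bad relations between them, are all unlikely,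
then all can be avoided. -/
theorem exists_pair_of_prob_lt [Nonempty Ω] {Bad : Ω → Prop} {R R' : Ω → Ω → Prop}
    (hB : prob Bad < 1 / 4) (hR : ∀ x, ¬ Bad x → prob (R x) < 1 / 4)
    (hR' : ∀ y, ¬ Bad y → prob (R' y) < 1 / 4) :
    ∃ x y, ¬ Bad x ∧ ¬ Bad y ∧ ¬ R x y ∧ ¬ R' y x := by
  classical
  by_contra! h
  have hN : (0 : ℝ) < Fintype.card Ω := by exact_mod_cast Fintype.card_pos
  have key : (univ : Finset (Ω × Ω)) ⊆ (({x | Bad x} : Finset Ω) ×ˢ univ) ∪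
      (univ ×ˢ ({x | Bad x} : Finset Ω)) ∪
      ({z | ¬ Bad z.1 ∧ R z.1 z.2} : Finset (Ω × Ω)) ∪
      ({z | ¬ Bad z.2 ∧ R' z.2 z.1} : Finset (Ω × Ω)) := by
    rintro ⟨x, y⟩ -
    have := h x y
    simp only [mem_union, mem_product, mem_filter, mem_univ, true_and, and_true]
    tauto
  have h1 : ∀ (S : Ω → Ω → Prop), (∀ x, ¬ Bad x → prob (S x) < 1 / 4) →
      (#({z | ¬ Bad z.1 ∧ S z.1 z.2} : Finset (Ω × Ω)) : ℝ) ≤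
        (Fintype.card Ω : ℝ) * (1 / 4 * Fintype.card Ω) := by
    intro S hS
    have : ({z | ¬ Bad z.1 ∧ S z.1 z.2} : Finset (Ω × Ω)) =
        (univ : Finset Ω).biUnion fun x => ({y | ¬ Bad x ∧ S x y} : Finset Ω).image (Prod.mk x) := by
      ext ⟨x, y⟩; simp
    rw [this]
    refine (Nat.cast_le.2 (Finset.card_biUnion_le)).trans ?_
    push_cast
    have : ∀ x ∈ (univ : Finset Ω),
        ((#(({y | ¬ Bad x ∧ S x y} : Finset Ω).image (Prod.mk x)) : ℕ) : ℝ) ≤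
          1 / 4 * Fintype.card Ω := by
      intro x _
      by_cases hx : Bad x
      · simp [hx]
      · refine (Nat.cast_le.2 Finset.card_image_le).trans ?_
        simp only [hx, not_false_eq_true, true_and]
        rw [card_filter_eq_prob_mul]
        have := hS x hx
        gcongr
    simpa using Finset.sum_le_card_nsmul _ _ _ this
  have h2 : (#({z | ¬ Bad z.2 ∧ R' z.2 z.1} : Finset (Ω × Ω)) : ℝ) ≤
        (Fintype.card Ω : ℝ) * (1 / 4 * Fintype.card Ω) := by
    refine le_trans (Nat.cast_le.2 ?_) (h1 R' hR')
    refine Finset.card_le_card_of_injOn Prod.swap ?_ (Prod.swap_injective.injOn)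
    intro z; simp
  have h3 : (#({x | Bad x} : Finset Ω) : ℝ) < 1 / 4 * Fintype.card Ω := by
    rw [card_filter_eq_prob_mul]
    gcongr
  have h4 := (Finset.card_le_card key).trans ((Finset.card_union_le _ _).trans
    (Nat.add_le_add_right ((Finset.card_union_le _ _).trans
    (Nat.add_le_add_right (Finset.card_union_le _ _) _)) _))
  have h5 := (Nat.cast_le (α := ℝ)).2 h4
  push_cast [Finset.card_product, Finset.card_univ, Fintype.card_prod] at h5
  have := h1 R hR
  nlinarith

end Prob

section Pi

variable {E X : Type*} [Fintype E] [DecidableEq E] [Fintype X] [Nonempty X]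

theorem prob_forall_mem (Y : Finset E) (B : Finset X) :
    prob (fun f : E → X => ∀ e ∈ Y, f e ∈ B) = ((#B : ℝ) / Fintype.card X) ^ #Y := by
  classical
  have h : ({f | ∀ e ∈ Y, f e ∈ B} : Finset (E → X)) =
      Fintype.piFinset fun e => if e ∈ Y then B else univ := by
    ext f
    simp only [mem_filter, mem_univ, true_and, Fintype.mem_piFinset]
    refine forall_congr' fun e => ?_
    split_ifs with he <;> simp [he]
  have hX : (Fintype.card X : ℝ) ≠ 0 := by simp
  unfold prob
  have h' := congrArg Finset.card h
  rw [Fintype.card_piFinset] at h'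
  have h2 : (#{f : E → X | ∀ e ∈ Y, f e ∈ B} : ℝ) / Fintype.card (E → X) =
      ((#B : ℝ) / Fintype.card X) ^ #Y := ?_
  · convert h2
  rw [h', Fintype.card_pi]
  push_cast
  rw [← Finset.prod_div_distrib, div_pow, ← Finset.prod_const, ← Finset.prod_const,
    ← Finset.prod_div_distrib]
  rw [← Finset.prod_subset (Finset.subset_univ Y)]
  · exact Finset.prod_congr rfl fun e he => by simp [he]
  · intro e _ he
    simp [he, hX]

theorem choose_le_exp_mul_div_pow (n y : ℕ) :
    (n.choose y : ℝ) ≤ (Real.exp 1 * n / y) ^ y := by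
  rcases Nat.eq_zero_or_pos y with rfl | hy
  · simp
  have hy' : (0 : ℝ) < y := by exact_mod_cast hy
  refine (Nat.choose_le_pow_div y n).trans ?_
  have h := Real.pow_div_factorial_le_exp (y : ℝ) hy'.le y
  have hf : (0 : ℝ) < y.factorial := by exact_mod_cast y.factorial_pos
  rw [div_le_iff₀ hf] at h ⊢
  have h2 : Real.exp (y : ℝ) = Real.exp 1 ^ y := by rw [← Real.exp_nat_mul]; simp
  rw [h2] at h
  calc (n : ℝ) ^ y = (n / y : ℝ) ^ y * (y : ℝ) ^ y := by
        rw [← mul_pow]; congr 1; field_simp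
    _ ≤ (n / y : ℝ) ^ y * (Real.exp 1 ^ y * y.factorial) := by gcongr
    _ = _ := by rw [mul_div_assoc, mul_pow]; ring

/-- Union bound for `y` disjoint groups of `j` coordinates all landing in `B`. -/
theorem prob_exists_disjoint_le {ι : Type*} [DecidableEq ι] (I : Finset ι) (g : ι → Finset E)
    (B : Finset X) (j y : ℕ) :
    prob (fun f : E → X => ∃ J ⊆ I, #J = y ∧ (J : Set ι).PairwiseDisjoint g ∧
      (∀ i ∈ J, #(g i) = j) ∧ ∀ i ∈ J, ∀ e ∈ g i, f e ∈ B) ≤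
      (Real.exp 1 * #I * ((#B : ℝ) / Fintype.card X) ^ j / y) ^ y := by
  classical
  set p : ℝ := (#B : ℝ) / Fintype.card X with hp
  have hp0 : 0 ≤ p := by positivity
  have h1 : prob (fun f : E → X => ∃ J ⊆ I, #J = y ∧ (J : Set ι).PairwiseDisjoint g ∧
      (∀ i ∈ J, #(g i) = j) ∧ ∀ i ∈ J, ∀ e ∈ g i, f e ∈ B) ≤
      prob (fun f : E → X => ∃ J ∈ (I.powersetCard y).filter
        (fun J : Finset ι => (J : Set ι).PairwiseDisjoint g ∧ ∀ i ∈ J, #(g i) = j),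
        ∀ e ∈ J.biUnion g, f e ∈ B) := by
    refine prob_mono ?_
    rintro f ⟨J, hJ, hc, hd, hg, hf⟩
    refine ⟨J, ?_, ?_⟩
    · simp only [mem_filter, mem_powersetCard]
      exact ⟨⟨hJ, hc⟩, hd, hg⟩
    · simpa using fun e i hi he => hf i hi e he
  refine h1.trans ((prob_exists_le_card_mul (c := (p ^ j) ^ y) ?_).trans ?_)
  · intro J hJ
    simp only [mem_filter, mem_powersetCard] at hJ
    obtain ⟨⟨_, hc⟩, hd, hg⟩ := hJ
    rw [prob_forall_mem, Finset.card_biUnion (fun a ha b hb hab => hd ha hb hab),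
      Finset.sum_congr rfl hg, Finset.sum_const, hc, ← pow_mul, smul_eq_mul, mul_comm y j]
  · have h2 : ((#((I.powersetCard y).filter
        (fun J : Finset ι => (J : Set ι).PairwiseDisjoint g ∧ ∀ i ∈ J, #(g i) = j)) : ℕ) : ℝ) ≤
        (#I).choose y := by
      rw [← Finset.card_powersetCard]
      exact_mod_cast Finset.card_filter_le _ _
    calc _ ≤ ((#I).choose y : ℝ) * (p ^ j) ^ y := by gcongr
      _ ≤ (Real.exp 1 * #I / y) ^ y * (p ^ j) ^ y := by
        gcongr; exact choose_le_exp_mul_div_pow _ _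
      _ = _ := by rw [← mul_pow]; congr 1; ring

/-- It is unlikely that at most `y` of the coordinates in `Y` land in `B`. -/
theorem prob_card_le_le [DecidableEq X] (Y : Finset E) (B : Finset X) {y : ℕ} (hge : y ≤ #Y) :
    prob (fun f : E → X => #{e ∈ Y | f e ∈ B} ≤ y) ≤
      (#Y : ℝ) ^ y * Real.exp (-((#B : ℝ) / Fintype.card X) * (#Y - y)) := by
  classical
  set p : ℝ := (#B : ℝ) / Fintype.card X with hp
  have hX : (0 : ℝ) < Fintype.card X := by exact_mod_cast Fintype.card_pos
  have hp0 : 0 ≤ p := by positivity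
  have hp1 : p ≤ 1 := by
    rw [hp, div_le_one hX]; exact_mod_cast Finset.card_le_univ B
  have hq : ((#Bᶜ : ℕ) : ℝ) / Fintype.card X = 1 - p := by
    rw [Finset.card_compl, Nat.cast_sub (Finset.card_le_univ B), sub_div, div_self hX.ne']
  have h1 : prob (fun f : E → X => #{e ∈ Y | f e ∈ B} ≤ y) ≤
      prob (fun f : E → X => ∃ J ∈ Y.powersetCard y, ∀ e ∈ Y \ J, f e ∈ Bᶜ) := by
    refine prob_mono fun f hf => ?_
    obtain ⟨J, h1, h2, h3⟩ := Finset.exists_subsuperset_card_eq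
      (Finset.filter_subset (fun e => f e ∈ B) Y) hf hge
    refine ⟨J, by simp [h2, h3], ?_⟩
    intro e he
    simp only [mem_sdiff, mem_compl] at he ⊢
    intro hb
    exact he.2 (h1 (by simp [he.1, hb]))
  refine h1.trans ((prob_exists_le_card_mul
    (c := Real.exp (-p * (#Y - y))) ?_).trans ?_)
  · intro J hJ
    rw [mem_powersetCard] at hJ
    rw [prob_forall_mem, hq, Finset.card_sdiff_of_subset hJ.1, hJ.2, mul_comm,
      ← Nat.cast_sub hge, Real.exp_nat_mul]
    exact pow_le_pow_left₀ (by linarith) (Real.one_sub_le_exp_neg p) _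
  · gcongr
    rw [Finset.card_powersetCard]
    exact_mod_cast Nat.choose_le_pow _ _

end Pi

/-! ### Random graphs -/

/-- The graph on `W` whose edges are the pairs with label in `B`. -/
def labelGraph {W X : Type*} (B : Finset X) (f : Sym2 W → X) : SimpleGraph W where
  Adj u v := u ≠ v ∧ f s(u, v) ∈ B
  symm := ⟨fun u v h => ⟨h.1.symm, by rw [Sym2.eq_swap]; exact h.2⟩⟩
  loopless := ⟨fun u h => h.1 rfl⟩

instance {W X : Type*} [DecidableEq W] [DecidableEq X] (B : Finset X) (f : Sym2 W → X) :
    DecidableRel (labelGraph B f).Adj :=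
  fun u v => inferInstanceAs (Decidable (u ≠ v ∧ f s(u, v) ∈ B))

/-- The three edges of a triple of vertices. -/
def triEdges {W : Type*} [DecidableEq W] (z : W × W × W) : Finset (Sym2 W) :=
  {s(z.1, z.2.1), s(z.1, z.2.2), s(z.2.1, z.2.2)}

section LabelGraph

variable {W X : Type*} [Fintype W] [DecidableEq W] [Fintype X] [Nonempty X]

theorem prob_exists_degree_ge_le [DecidableEq X] (B : Finset X) (y : ℕ) :
    prob (fun f : Sym2 W → X => ∃ v, y ≤ #{b | (labelGraph B f).Adj v b}) ≤
      Fintype.card W *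
        (Real.exp 1 * Fintype.card W * ((#B : ℝ) / Fintype.card X) / y) ^ y := by
  have h : prob (fun f : Sym2 W → X => ∃ v, y ≤ #{b | (labelGraph B f).Adj v b}) ≤
      prob (fun f : Sym2 W → X => ∃ v ∈ (univ : Finset W),
        y ≤ #{b | (labelGraph B f).Adj v b}) := prob_mono (by simp)
  refine h.trans ((prob_exists_le_card_mul fun v _ => ?_))
  have h2 := prob_exists_disjoint_le (univ : Finset W) (fun b => ({s(v, b)} : Finset (Sym2 W)))
    B 1 y
  rw [pow_one, Finset.card_univ] at h2
  refine (prob_mono fun f hf => ?_).trans h2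
  obtain ⟨J, hJ, hc⟩ := Finset.exists_subset_card_eq hf
  refine ⟨J, subset_univ _, hc, ?_, by simp, ?_⟩
  · intro b _ b' _ hbb
    simp only [Function.onFun, Finset.disjoint_singleton, ne_eq, Sym2.eq_iff]
    grind
  · intro b hb e he
    have := hJ hb
    simp only [mem_filter, mem_univ, true_and, mem_singleton] at this he
    rw [he]; exact this.2

theorem prob_exists_codegree_ge_le [DecidableEq X] (B : Finset X) (y : ℕ) :
    prob (fun f : Sym2 W → X => ∃ u v, u ≠ v ∧
      y ≤ #{c | (labelGraph B f).Adj u c ∧ (labelGraph B f).Adj v c}) ≤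
      (Fintype.card W : ℝ) ^ 2 *
        (Real.exp 1 * Fintype.card W * ((#B : ℝ) / Fintype.card X) ^ 2 / y) ^ y := by
  have h : prob (fun f : Sym2 W → X => ∃ u v, u ≠ v ∧
      y ≤ #{c | (labelGraph B f).Adj u c ∧ (labelGraph B f).Adj v c}) ≤
      prob (fun f : Sym2 W → X => ∃ z ∈ (univ : Finset (W × W)), z.1 ≠ z.2 ∧
        y ≤ #{c | (labelGraph B f).Adj z.1 c ∧ (labelGraph B f).Adj z.2 c}) :=
    prob_mono (by simp)
  refine h.trans ((prob_exists_le_card_mul fun z _ => ?_).trans_eq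
    (by rw [Finset.card_univ, Fintype.card_prod, Nat.cast_mul, sq]))
  obtain ⟨u, v⟩ := z
  have h2 := prob_exists_disjoint_le (univ : Finset W)
    (fun c => ({s(u, c), s(v, c)} : Finset (Sym2 W))) B 2 y
  rw [Finset.card_univ] at h2
  refine (prob_mono fun f hf => ?_).trans h2
  obtain ⟨huv, hf⟩ := hf
  obtain ⟨J, hJ, hc⟩ := Finset.exists_subset_card_eq hf
  have hJ' : ∀ c ∈ J, (u ≠ c ∧ f s(u, c) ∈ B) ∧ (v ≠ c ∧ f s(v, c) ∈ B) := fun c hcJ => by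
    simpa only [mem_filter, mem_univ, true_and] using! hJ hcJ
  refine ⟨J, subset_univ _, hc, ?_, ?_, ?_⟩
  · intro c hcJ c' hcJ' hne
    have h3 := hJ' c hcJ
    have h4 := hJ' c' hcJ'
    simp only [Function.onFun]
    rw [Finset.disjoint_left]
    intro e he he'
    simp only [mem_insert, mem_singleton] at he he'
    rcases he with rfl | rfl <;> rcases he' with he' | he' <;>
      simp only [Sym2.eq_iff] at he' <;> grind
  · intro c hcJ
    rw [Finset.card_pair]
    simp only [ne_eq, Sym2.eq_iff]
    grind
  · intro c hcJ e he
    have h3 := hJ' c hcJ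
    simp only [mem_insert, mem_singleton] at he
    rcases he with rfl | rfl
    · exact h3.1.2
    · exact h3.2.2

/-- Counting ordered adjacent pairs at most doubles the number of underlying edges. -/
theorem card_le_two_mul_card_image_sym2 {α : Type*} [DecidableEq α] (O : Finset (α × α)) :
    #O ≤ 2 * #(O.image fun z => s(z.1, z.2)) := by
  refine Finset.card_le_mul_card_image O 2 fun e he => ?_
  obtain ⟨⟨u, v⟩, -, rfl⟩ := Finset.mem_image.1 he
  refine (Finset.card_le_card (t := {(u, v), (v, u)}) ?_).trans Finset.card_le_two
  rintro ⟨a, b⟩ hab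
  simp only [mem_filter, Sym2.eq_iff, mem_insert, mem_singleton, Prod.mk.injEq] at hab ⊢
  exact hab.2

theorem prob_exists_edges_ge_le [DecidableEq X] (B : Finset X) (α β y : ℕ) :
    prob (fun f : Sym2 W → X => ∃ A C : Finset W, #A = α ∧ #C = β ∧
      2 * y ≤ ∑ v ∈ A, #{b ∈ C | (labelGraph B f).Adj v b}) ≤
      (Fintype.card W : ℝ) ^ (α + β) *
        (Real.exp 1 * (α * β) * ((#B : ℝ) / Fintype.card X) / y) ^ y := by
  have h : prob (fun f : Sym2 W → X => ∃ A C : Finset W, #A = α ∧ #C = β ∧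
      2 * y ≤ ∑ v ∈ A, #{b ∈ C | (labelGraph B f).Adj v b}) ≤
      prob (fun f : Sym2 W → X => ∃ z ∈ powersetCard α (univ : Finset W) ×ˢ
        powersetCard β (univ : Finset W),
        2 * y ≤ ∑ v ∈ z.1, #{b ∈ z.2 | (labelGraph B f).Adj v b}) := by
    refine prob_mono ?_
    rintro f ⟨A, C, hA, hC, hf⟩
    exact ⟨(A, C), by simp [hA, hC], hf⟩
  refine h.trans ((prob_exists_le_card_mul
    (c := (Real.exp 1 * (α * β) * ((#B : ℝ) / Fintype.card X) / y) ^ y) ?_).trans ?_)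
  · rintro ⟨A, C⟩ hz
    simp only [mem_product, mem_powersetCard, subset_univ, true_and] at hz
    have h2 := prob_exists_disjoint_le ((A ×ˢ C).image fun z => s(z.1, z.2))
      (fun e => ({e} : Finset (Sym2 W))) B 1 y
    rw [pow_one] at h2
    refine (prob_mono fun f hf => ?_).trans (h2.trans ?_)
    · set O := (A ×ˢ C).filter (fun z => (labelGraph B f).Adj z.1 z.2) with hO
      have hcard : ∑ v ∈ A, #{b ∈ C | (labelGraph B f).Adj v b} = #O := by
        rw [hO, Finset.card_filter, Finset.sum_product]
        exact Finset.sum_congr rfl fun v _ => by rw [Finset.card_filter]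
      have h3 := card_le_two_mul_card_image_sym2 O
      obtain ⟨J, hJ, hc⟩ := Finset.exists_subset_card_eq
        (show y ≤ #(O.image fun z => s(z.1, z.2)) by simp only at hf; omega)
      refine ⟨J, hJ.trans (Finset.image_subset_image (Finset.filter_subset _ _)), hc, ?_, by simp, ?_⟩
      · intro b _ b' _ hbb
        simp [Function.onFun, hbb]
      · intro b hb e he
        rw [mem_singleton] at he
        obtain ⟨z, hz1, rfl⟩ := Finset.mem_image.1 (hJ hb)
        rw [he]
        exact (Finset.mem_filter.1 hz1).2.2
    · have : ((#((A ×ˢ C).image fun z => s(z.1, z.2)) : ℕ) : ℝ) ≤ α * β := by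
        have := (Finset.card_image_le (s := A ×ˢ C) (f := fun z => s(z.1, z.2)))
        rw [Finset.card_product, hz.1, hz.2] at this
        exact_mod_cast this
      gcongr
  · gcongr
    rw [Finset.card_product, Finset.card_powersetCard, Finset.card_powersetCard, Finset.card_univ,
      pow_add]
    push_cast
    gcongr <;> exact_mod_cast Nat.choose_le_pow _ _

theorem card_triples_meeting_le (T : Finset W) :
    #{z : W × W × W | ∃ e ∈ triEdges z, e ∈ T.sym2} ≤ 3 * (#T ^ 2 * Fintype.card W) := by
  have hsub : ({z : W × W × W | ∃ e ∈ triEdges z, e ∈ T.sym2} : Finset (W × W × W)) ⊆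
      ((T ×ˢ T ×ˢ (univ : Finset W)) ∪ (T ×ˢ (univ : Finset W) ×ˢ T)) ∪
        ((univ : Finset W) ×ˢ T ×ˢ T) := by
    rintro ⟨a, b, c⟩ h
    simp only [triEdges, mem_filter, mem_univ, true_and, mem_insert, mem_singleton,
      exists_eq_or_imp, exists_eq_left, Finset.mk_mem_sym2_iff] at h
    simp only [mem_union, mem_product, mem_univ, true_and, and_true]
    tauto
  refine (Finset.card_le_card hsub).trans ((Finset.card_union_le _ _).trans
    ((Nat.add_le_add_right (Finset.card_union_le _ _) _).trans_eq ?_))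
  simp only [Finset.card_product, Finset.card_univ]
  ring

theorem prob_exists_triangles_ge_le (B : Finset X) (α y : ℕ) :
    prob (fun f : Sym2 W → X => ∃ T : Finset W, #T = α ∧ ∃ J : Finset (W × W × W), #J = y ∧
      (J : Set (W × W × W)).PairwiseDisjoint triEdges ∧ ∀ z ∈ J, #(triEdges z) = 3 ∧
        (∃ e ∈ triEdges z, e ∈ T.sym2) ∧ ∀ e ∈ triEdges z, f e ∈ B) ≤
      (Fintype.card W : ℝ) ^ α *
        (Real.exp 1 * (3 * (α ^ 2 * Fintype.card W)) * ((#B : ℝ) / Fintype.card X) ^ 3 / y) ^ y := by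
  have h : prob (fun f : Sym2 W → X => ∃ T : Finset W, #T = α ∧
      ∃ J : Finset (W × W × W), #J = y ∧
      (J : Set (W × W × W)).PairwiseDisjoint triEdges ∧ ∀ z ∈ J, #(triEdges z) = 3 ∧
        (∃ e ∈ triEdges z, e ∈ T.sym2) ∧ ∀ e ∈ triEdges z, f e ∈ B) ≤
      prob (fun f : Sym2 W → X => ∃ T ∈ powersetCard α (univ : Finset W),
        ∃ J ⊆ ({z : W × W × W | ∃ e ∈ triEdges z, e ∈ T.sym2} : Finset (W × W × W)), #J = y ∧
      (J : Set (W × W × W)).PairwiseDisjoint triEdges ∧ (∀ z ∈ J, #(triEdges z) = 3) ∧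
        ∀ z ∈ J, ∀ e ∈ triEdges z, f e ∈ B) := by
    refine prob_mono ?_
    rintro f ⟨T, hT, J, hJ, hd, hf⟩
    refine ⟨T, by simp [hT], J, fun z hz => ?_, hJ, hd, fun z hz => (hf z hz).1,
      fun z hz => (hf z hz).2.2⟩
    simpa using (hf z hz).2.1
  refine h.trans ((prob_exists_le_card_mul
    (c := (Real.exp 1 * (3 * (α ^ 2 * Fintype.card W)) *
      ((#B : ℝ) / Fintype.card X) ^ 3 / y) ^ y) ?_).trans ?_)
  · intro T hT
    rw [mem_powersetCard] at hT
    refine (prob_exists_disjoint_le _ triEdges B 3 y).trans ?_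
    have := card_triples_meeting_le T
    rw [hT.2] at this
    have : ((#{z : W × W × W | ∃ e ∈ triEdges z, e ∈ T.sym2} : ℕ) : ℝ) ≤
      3 * (α ^ 2 * Fintype.card W) := by exact_mod_cast this
    gcongr
  · gcongr
    rw [Finset.card_powersetCard, Finset.card_univ]
    exact_mod_cast Nat.choose_le_pow _ _

end LabelGraph

/-- Deleting a maximal family of edge-disjoint triangles destroys all triangles. -/
theorem exists_cliqueFree_three_of_forall_disjoint {W : Type*} [Fintype W] [DecidableEq W]
    (H : SimpleGraph W) {α y : ℕ}
    (h : ∀ T : Finset W, #T = α → ∀ J : Finset (W × W × W),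
      (J : Set (W × W × W)).PairwiseDisjoint triEdges → (∀ z ∈ J, #(triEdges z) = 3 ∧
        (∃ e ∈ triEdges z, e ∈ T.sym2) ∧ ∀ e ∈ triEdges z, e ∈ H.edgeSet) → #J ≠ y) :
    ∃ H' ≤ H, H'.CliqueFree 3 ∧ ∃ D : Finset (Sym2 W),
      (∀ u v, H.Adj u v → ¬ H'.Adj u v → s(u, v) ∈ D) ∧
      ∀ T : Finset W, #T = α → #{e ∈ D | e ∈ T.sym2} ≤ 3 * y := by
  classical
  have hcard : ∀ {a b c : W}, a ≠ b → a ≠ c → b ≠ c → #(triEdges (a, b, c)) = 3 := by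
    intro a b c hab hac hbc
    rw [triEdges, Finset.card_eq_three]
    exact ⟨_, _, _, by simp only [ne_eq, Sym2.eq_iff]; grind,
      by simp only [ne_eq, Sym2.eq_iff]; grind, by simp only [ne_eq, Sym2.eq_iff]; grind, rfl⟩
  set 𝓕 : Finset (Finset (W × W × W)) := {F | (F : Set (W × W × W)).PairwiseDisjoint triEdges ∧
    ∀ z ∈ F, #(triEdges z) = 3 ∧ ∀ e ∈ triEdges z, e ∈ H.edgeSet} with h𝓕
  obtain ⟨F, hF, hmax⟩ := Finset.exists_max_image 𝓕 Finset.card ⟨∅, by simp [h𝓕]⟩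
  obtain ⟨hFd, hF3⟩ : (F : Set (W × W × W)).PairwiseDisjoint triEdges ∧
    ∀ z ∈ F, #(triEdges z) = 3 ∧ ∀ e ∈ triEdges z, e ∈ H.edgeSet := by simpa [h𝓕] using hF
  refine ⟨H.deleteEdges (F.biUnion triEdges : Finset (Sym2 W)), H.deleteEdges_le _, ?_,
    F.biUnion triEdges, ?_, ?_⟩
  · intro s hs
    rw [SimpleGraph.is3Clique_iff] at hs
    obtain ⟨a, b, c, hab, hac, hbc, -⟩ := hs
    rw [SimpleGraph.deleteEdges_adj] at hab hac hbc
    have hnew : ∀ z ∈ F, Disjoint (triEdges (a, b, c)) (triEdges z) := by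
      intro z hz
      rw [Finset.disjoint_left]
      intro e he hez
      have hmem : e ∈ F.biUnion triEdges := Finset.mem_biUnion.2 ⟨z, hz, hez⟩
      simp only [triEdges, mem_insert, mem_singleton] at he
      rcases he with rfl | rfl | rfl
      · exact hab.2 (by exact_mod_cast hmem)
      · exact hac.2 (by exact_mod_cast hmem)
      · exact hbc.2 (by exact_mod_cast hmem)
    have hnot : (a, b, c) ∉ F := fun hmem => by
      have := hnew _ hmem
      simp [triEdges] at this
    have hins : insert (a, b, c) F ∈ 𝓕 := by
      simp only [h𝓕, mem_filter, mem_univ, true_and, Finset.mem_insert, forall_eq_or_imp]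
      refine ⟨?_, ⟨hcard hab.1.ne hac.1.ne hbc.1.ne, ?_⟩, hF3⟩
      · rw [Finset.coe_insert]
        exact hFd.insert fun z hz _ => hnew z (by exact_mod_cast hz)
      · intro e he
        simp only [triEdges, mem_insert, mem_singleton] at he
        rcases he with rfl | rfl | rfl
        · exact hab.1
        · exact hac.1
        · exact hbc.1
    have := hmax _ hins
    rw [Finset.card_insert_of_notMem hnot] at this
    omega
  · intro u v huv hn
    by_contra hD
    exact hn (by rw [SimpleGraph.deleteEdges_adj]; exact ⟨huv, by exact_mod_cast hD⟩)
  · intro T hT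
    obtain ⟨J, hJ⟩ : ∃ J : Finset (W × W × W), ∀ z, z ∈ J ↔
        z ∈ F ∧ ∃ e ∈ triEdges z, e ∈ T.sym2 := ⟨F.filter _, fun z => Finset.mem_filter⟩
    have hJy : #J ≤ y := by
      by_contra! hlt
      obtain ⟨J', hJ', hc⟩ := Finset.exists_subset_card_eq hlt.le
      refine h T hT J' (hFd.subset ?_) ?_ hc
      · exact_mod_cast fun z hz => ((hJ z).1 (hJ' hz)).1
      · intro z hz
        have := (hJ z).1 (hJ' hz)
        exact ⟨(hF3 z this.1).1, this.2, (hF3 z this.1).2⟩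
    have hsub : {e ∈ F.biUnion triEdges | e ∈ T.sym2} ⊆ J.biUnion triEdges := by
      intro e he
      simp only [mem_filter, mem_biUnion, hJ] at he ⊢
      obtain ⟨⟨z, hz, hez⟩, heT⟩ := he
      exact ⟨z, ⟨hz, e, hez, heT⟩, hez⟩
    have h3 : ∀ z ∈ J, #(triEdges z) = 3 := fun z hz => (hF3 z ((hJ z).1 hz).1).1
    refine (Finset.card_le_card hsub).trans (Finset.card_biUnion_le.trans ?_)
    rw [Finset.sum_congr rfl h3, Finset.sum_const, smul_eq_mul]
    omega

/-! ### Pairs with a common neighbour in a blow-up -/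

section Blowup

variable {V W : Type*} [Fintype W]
  (H : SimpleGraph W) [DecidableRel H.Adj]

/-- The number of neighbours of `v` in the blow-up of `H` along `g` lying in `S`. -/
def blowDegree (g : V → W) (S : Finset V) (v : W) : ℕ := #{u ∈ S | H.Adj v (g u)}

variable {H}

theorem sum_blowDegree_le {g : V → W} {S : Finset V} {Δ : ℕ}
    (hdeg : ∀ v, #{b | H.Adj v b} ≤ Δ) : ∑ v, blowDegree H g S v ≤ #S * Δ := by
  have h : ∑ v, blowDegree H g S v = ∑ u ∈ S, #{v | H.Adj v (g u)} :=
    Finset.sum_card_bipartiteAbove_eq_sum_card_bipartiteBelow (fun v u => H.Adj v (g u))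
      (s := univ) (t := S)
  rw [h, ← smul_eq_mul]
  refine Finset.sum_le_card_nsmul _ _ _ fun u _ => ?_
  simpa [SimpleGraph.adj_comm] using hdeg (g u)

/-- If sets `Q` of size at most `β` send few edges to `T`, few vertices have many
neighbours in `T`. -/
theorem card_filter_lt_and_sum_le {T : Finset W} {β θ c : ℕ} (hβ : 0 < β) (hθ : c ≤ θ * β)
    (hedge : ∀ Q : Finset W, #Q ≤ β → ∑ v ∈ Q, #{b ∈ T | H.Adj v b} ≤ c) :
    #{v | θ < #{b ∈ T | H.Adj v b}} ≤ β ∧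
      ∑ v with θ < #{b ∈ T | H.Adj v b}, #{b ∈ T | H.Adj v b} ≤ c := by
  have h : #{v | θ < #{b ∈ T | H.Adj v b}} ≤ β := by
    by_contra! hlt
    obtain ⟨Q, hQ, hc⟩ := Finset.exists_subset_card_eq hlt.le
    have h1 := hedge Q hc.le
    have h2 : #Q • (θ + 1) ≤ ∑ v ∈ Q, #{b ∈ T | H.Adj v b} :=
      Finset.card_nsmul_le_sum _ _ _ fun v hv => (Finset.mem_filter.1 (hQ hv)).2
    rw [hc, smul_eq_mul] at h2
    nlinarith
  exact ⟨h, hedge _ h⟩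

variable [DecidableEq W]

theorem blowDegree_le_mul {g : V → W} {S : Finset V} {n : ℕ}
    (hfib : ∀ b, #{u ∈ S | g u = b} ≤ n) (v : W) :
    blowDegree H g S v ≤ n * #{b ∈ S.image g | H.Adj v b} := by
  refine (Finset.card_le_mul_card_image (f := g) _ n fun b _ => ?_).trans
    (Nat.mul_le_mul_left _ (Finset.card_le_card ?_))
  · refine (Finset.card_le_card ?_).trans (hfib b)
    intro u; simp only [mem_filter]; tauto
  · intro b
    simp only [mem_image, mem_filter]
    rintro ⟨u, ⟨hu, huv⟩, rfl⟩
    exact ⟨⟨u, hu, rfl⟩, huv⟩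

theorem card_le_one_add_card_offDiag {α : Type*} [DecidableEq α] (s : Finset α) :
    #s ≤ 1 + #s.offDiag := by
  rw [Finset.offDiag_card]
  rcases Nat.lt_or_ge (#s) 2 with h | h
  · omega
  · have : 2 * #s ≤ #s * #s := Nat.mul_le_mul_right _ h
    omega

/-- With bounded codegrees, a small set of vertices has total degree little above `#S`. -/
theorem sum_blowDegree_le_of_codegree {g : V → W} {S : Finset V} {κ τ : ℕ}
    (hcod : ∀ u v, u ≠ v → #{c | H.Adj u c ∧ H.Adj v c} ≤ κ)
    (hfib : ∀ b, #{u ∈ S | g u = b} ≤ τ) (P : Finset W) :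
    ∑ v ∈ P, blowDegree H g S v ≤ #S + #P ^ 2 * (τ * κ) := by
  have h : ∑ v ∈ P, blowDegree H g S v = ∑ u ∈ S, #{v ∈ P | H.Adj v (g u)} :=
    Finset.sum_card_bipartiteAbove_eq_sum_card_bipartiteBelow (fun v u => H.Adj v (g u))
  have h2 : ∑ u ∈ S, #(({v ∈ P | H.Adj v (g u)} : Finset W).offDiag) =
      ∑ z ∈ P.offDiag, #{u ∈ S | H.Adj z.1 (g u) ∧ H.Adj z.2 (g u)} := by
    refine Eq.trans (Finset.sum_congr rfl fun u _ => congrArg _ ?_)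
      (Finset.sum_card_bipartiteAbove_eq_sum_card_bipartiteBelow
        (fun u (z : W × W) => H.Adj z.1 (g u) ∧ H.Adj z.2 (g u)) (s := S) (t := P.offDiag))
    ext ⟨v, v'⟩
    simp only [mem_offDiag, mem_filter, Finset.bipartiteAbove]
    tauto
  have h3 : ∀ z ∈ P.offDiag, #{u ∈ S | H.Adj z.1 (g u) ∧ H.Adj z.2 (g u)} ≤ τ * κ := by
    rintro ⟨v, v'⟩ hz
    refine (Finset.card_le_mul_card_image (f := g) _ τ fun b _ => ?_).trans
      (Nat.mul_le_mul_left _ ((Finset.card_le_card ?_).trans (hcod v v' (mem_offDiag.1 hz).2.2)))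
    · refine (Finset.card_le_card ?_).trans (hfib b)
      intro u; simp only [mem_filter]; tauto
    · intro b
      simp only [mem_image, mem_filter, mem_univ, true_and]
      rintro ⟨u, ⟨hu, huv⟩, rfl⟩
      exact huv
  rw [h]
  calc ∑ u ∈ S, #{v ∈ P | H.Adj v (g u)}
      ≤ ∑ u ∈ S, (1 + #(({v ∈ P | H.Adj v (g u)} : Finset W).offDiag)) :=
        Finset.sum_le_sum fun u _ => card_le_one_add_card_offDiag _
    _ = #S + ∑ z ∈ P.offDiag, #{u ∈ S | H.Adj z.1 (g u) ∧ H.Adj z.2 (g u)} := by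
        rw [Finset.sum_add_distrib, h2]; simp
    _ ≤ #S + #P.offDiag * (τ * κ) := by
        gcongr
        simpa using Finset.sum_le_card_nsmul _ _ _ h3
    _ ≤ #S + #P ^ 2 * (τ * κ) := by
        gcongr
        rw [Finset.offDiag_card, sq]
        omega

/-- The sum of squared degrees into `S`, which bounds the number of pairs in `S` with a common
neighbour in the blow-up. -/
theorem sum_sq_blowDegree_le {g : V → W} {S : Finset V} {a a' r Δ K κ : ℕ}
    (hdeg : ∀ v, #{b | H.Adj v b} ≤ Δ)
    (hcod : ∀ u v, u ≠ v → #{c | H.Adj u c ∧ H.Adj v c} ≤ κ)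
    (hedge : ∀ A C : Finset W, #A = a → #C = a' → ∑ v ∈ A, #{b ∈ C | H.Adj v b} ≤ K * a)
    (hfib : ∀ b, #{u ∈ S | g u = b} ≤ 8 * r ^ 2) (hS : #S = a) (ha : a = a' * r) (hr : 0 < r)
    (ha' : 0 < a') (hW : a ≤ Fintype.card W) (hP : a + 8 * κ * r ^ 8 < r ^ 9)
    (hκ : 8 * κ * r ^ 8 ≤ a) :
    ∑ v, blowDegree H g S v ^ 2 ≤ 9 * K * r ^ 2 * (a * Δ) + 16 * r ^ 2 * Δ * a +
      18 * r ^ 8 * K * a := by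
  have ha'a : a' ≤ a := by rw [ha]; exact Nat.le_mul_of_pos_right _ hr
  have hedge' : ∀ A C : Finset W, #A ≤ a → #C ≤ a' →
      ∑ v ∈ A, #{b ∈ C | H.Adj v b} ≤ K * a := by
    intro A C hA hC
    obtain ⟨A', hA', hA'c⟩ := Finset.exists_superset_card_eq hA hW
    obtain ⟨C', hC', hC'c⟩ := Finset.exists_superset_card_eq hC (ha'a.trans hW)
    refine le_trans ?_ (hedge A' C' hA'c hC'c)
    refine (Finset.sum_le_sum fun v _ => Finset.card_le_card ?_).trans
      (Finset.sum_le_sum_of_subset hA')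
    exact Finset.filter_subset_filter _ hC'
  have hswap : ∀ A C : Finset W, ∑ v ∈ A, #{b ∈ C | H.Adj v b} =
      ∑ v ∈ C, #{b ∈ A | H.Adj v b} := by
    intro A C
    have := Finset.sum_card_bipartiteAbove_eq_sum_card_bipartiteBelow H.Adj (s := A) (t := C)
    simp only [Finset.bipartiteAbove, Finset.bipartiteBelow] at this
    rw [this]
    simp only [SimpleGraph.adj_comm]
  set Sh := {u ∈ S | r < #{u' ∈ S | g u' = g u}} with hSh
  set Sl := {u ∈ S | ¬ r < #{u' ∈ S | g u' = g u}} with hSl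
  set d := blowDegree H g S with hd
  set dh := blowDegree H g Sh with hdh
  set dl := blowDegree H g Sl with hdl
  have hsplit : ∀ v, d v = dh v + dl v := by
    intro v
    simp only [hd, hdh, hdl, blowDegree, hSh, hSl, Finset.filter_filter]
    rw [← Finset.card_filter_add_card_filter_not
      (s := {u ∈ S | H.Adj v (g u)}) (fun u => r < #{u' ∈ S | g u' = g u}),
      Finset.filter_filter, Finset.filter_filter]
    simp only [and_comm]
  set Th := Sh.image g with hTh
  set Tl := Sl.image g with hTl
  have hThc : #Th ≤ a' := by
    have h1 : #Th • r ≤ #S := by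
      rw [Finset.card_eq_sum_card_image g S]
      refine le_trans (Finset.card_nsmul_le_sum Th (fun b => #{u' ∈ S | g u' = b}) r ?_)
        (Finset.sum_le_sum_of_subset (Finset.image_subset_image (Finset.filter_subset _ _)))
      intro b hb
      obtain ⟨u, hu, rfl⟩ := Finset.mem_image.1 hb
      exact (Finset.mem_filter.1 hu).2.le
    rw [hS, ha, smul_eq_mul] at h1
    exact Nat.le_of_mul_le_mul_right h1 hr
  have hTlc : #Tl ≤ a := (Finset.card_image_le.trans (Finset.card_filter_le _ _)).trans hS.le
  have hdhle : ∀ v, dh v ≤ 8 * r ^ 2 * #{b ∈ Th | H.Adj v b} :=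
    blowDegree_le_mul fun b => (Finset.card_le_card
      (Finset.filter_subset_filter _ (Finset.filter_subset _ _))).trans (hfib b)
  have hdlle : ∀ v, dl v ≤ r * #{b ∈ Tl | H.Adj v b} := by
    refine blowDegree_le_mul fun b => ?_
    rcases Finset.eq_empty_or_nonempty {u ∈ Sl | g u = b} with he | ⟨u, hu⟩
    · simp [he]
    · obtain ⟨hu1, rfl⟩ := Finset.mem_filter.1 hu
      refine (Finset.card_le_card
        (Finset.filter_subset_filter _ (Finset.filter_subset _ _))).trans ?_
      exact not_lt.1 (Finset.mem_filter.1 hu1).2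
  obtain ⟨hQh, hQhs⟩ := card_filter_lt_and_sum_le (H := H) (T := Th) (β := a) (θ := K) (c := K * a)
    (by omega) le_rfl (fun Q hQ => hedge' Q Th hQ hThc)
  obtain ⟨hQl, hQls⟩ := card_filter_lt_and_sum_le (H := H) (T := Tl) (β := a') (θ := K * r)
    (c := K * a) ha' (by rw [ha]; exact le_of_eq (by ring))
    (fun Q hQ => by rw [hswap]; exact hedge' Tl Q hTlc hQ)
  set Qh : Finset W := {v | K < #{b ∈ Th | H.Adj v b}} with hQhdef
  set Ql : Finset W := {v | K * r < #{b ∈ Tl | H.Adj v b}} with hQldef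
  have hdh' : ∀ v ∉ Qh, dh v ≤ 8 * r ^ 2 * K := fun v hv => (hdhle v).trans
    (Nat.mul_le_mul_left _ (by simpa [hQhdef] using hv))
  have hdl' : ∀ v ∉ Ql, dl v ≤ r ^ 2 * K := fun v hv => (hdlle v).trans
    ((Nat.mul_le_mul_left _ (by simpa [hQldef] using hv : _ ≤ K * r)).trans_eq (by ring))
  have hsum_h : ∑ v ∈ Qh, dh v ≤ 8 * r ^ 2 * (K * a) :=
    (Finset.sum_le_sum fun v _ => hdhle v).trans
      (by rw [← Finset.mul_sum]; exact Nat.mul_le_mul_left _ hQhs)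
  have hsum_l : ∑ v ∈ Ql, dl v ≤ r * (K * a) :=
    (Finset.sum_le_sum fun v _ => hdlle v).trans
      (by rw [← Finset.mul_sum]; exact Nat.mul_le_mul_left _ hQls)
  have hQsum : ∑ v ∈ Qh ∪ Ql, d v ≤ 18 * r ^ 2 * K * a := by
    have h1 : ∑ v ∈ Qh ∪ Ql, d v ≤ ∑ v ∈ Qh, dh v + ∑ v ∈ Ql, dl v +
        ∑ v ∈ Ql, 8 * r ^ 2 * K + ∑ v ∈ Qh, r ^ 2 * K := by
      have h2 : ∑ v ∈ Qh ∪ Ql, d v ≤ ∑ v, ((if v ∈ Qh then dh v else 0) +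
          (if v ∈ Ql then dl v else 0) + (if v ∈ Ql then 8 * r ^ 2 * K else 0) +
          (if v ∈ Qh then r ^ 2 * K else 0)) := by
        refine (Finset.sum_le_sum fun v hv => ?_).trans
          (Finset.sum_le_sum_of_subset (Finset.subset_univ _))
        have := hsplit v
        have := hdh' v
        have := hdl' v
        rw [mem_union] at hv
        split_ifs <;> grind
      refine h2.trans_eq ?_
      simp only [Finset.sum_add_distrib, Finset.sum_ite_mem, Finset.univ_inter]
    rw [Finset.sum_const, Finset.sum_const, smul_eq_mul, smul_eq_mul] at h1
    have h3 : #Ql * (8 * r ^ 2 * K) ≤ a * (8 * r ^ 2 * K) :=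
      Nat.mul_le_mul_right _ (hQl.trans ha'a)
    have h4 : #Qh * (r ^ 2 * K) ≤ a * (r ^ 2 * K) := Nat.mul_le_mul_right _ hQh
    have h5 : r * (K * a) ≤ r ^ 2 * (K * a) :=
      Nat.mul_le_mul_right _ (Nat.le_self_pow (by norm_num) r)
    nlinarith
  set P : Finset W := {v | r ^ 6 ≤ d v} with hPdef
  have hPc : #P ≤ r ^ 3 := by
    by_contra! hlt
    obtain ⟨P', hP', hc⟩ := Finset.exists_subset_card_eq hlt.le
    have h1 := sum_blowDegree_le_of_codegree (H := H) hcod hfib P'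
    have h2 : #P' • r ^ 6 ≤ ∑ v ∈ P', d v :=
      Finset.card_nsmul_le_sum _ _ _ fun v hv => (Finset.mem_filter.1 (hP' hv)).2
    rw [hc, hS] at h1
    rw [hc, smul_eq_mul] at h2
    have := h2.trans h1
    ring_nf at this hP
    omega
  have hPsum : ∑ v ∈ P, d v ≤ 2 * a := by
    have h1 := sum_blowDegree_le_of_codegree (H := H) hcod hfib P
    have h2 : #P ^ 2 * (8 * r ^ 2 * κ) ≤ (r ^ 3) ^ 2 * (8 * r ^ 2 * κ) := by gcongr
    rw [hS] at h1
    have := h1.trans (Nat.add_le_add_left h2 _)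
    refine this.trans ?_
    ring_nf at hκ ⊢
    omega
  have hdmax : ∀ v, d v ≤ 8 * r ^ 2 * Δ := fun v =>
    (blowDegree_le_mul hfib v).trans (Nat.mul_le_mul_left _ ((Finset.card_le_card
      (Finset.filter_subset_filter _ (Finset.subset_univ _))).trans (hdeg v)))
  have hpt : ∀ v, d v ^ 2 ≤ 9 * K * r ^ 2 * d v + (if v ∈ P then 8 * r ^ 2 * Δ * d v else 0) +
      (if v ∈ Qh ∪ Ql then r ^ 6 * d v else 0) := by
    intro v
    rw [sq]
    by_cases h1 : v ∈ P
    · have := Nat.mul_le_mul_right (d v) (hdmax v)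
      simp only [h1, if_true]
      omega
    · by_cases h2 : v ∈ Qh ∪ Ql
      · have h3 : d v ≤ r ^ 6 := by
          simp only [hPdef, mem_filter, mem_univ, true_and, not_le] at h1
          exact h1.le
        have := Nat.mul_le_mul_right (d v) h3
        simp only [h2, if_true]
        omega
      · simp only [mem_union, not_or] at h2
        have h3 : d v ≤ 9 * K * r ^ 2 := by
          have := hsplit v
          have := hdh' v h2.1
          have := hdl' v h2.2
          nlinarith
        have := Nat.mul_le_mul_right (d v) h3
        omega
  refine (Finset.sum_le_sum fun v _ => hpt v).trans ?_
  simp only [Finset.sum_add_distrib, Finset.sum_ite_mem, Finset.univ_inter, ← Finset.mul_sum]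
  have h1 : ∑ v, d v ≤ a * Δ := hS ▸ sum_blowDegree_le (H := H) (g := g) (S := S) hdeg
  have e1 := Nat.mul_le_mul_left (9 * K * r ^ 2) h1
  have e2 := Nat.mul_le_mul_left (8 * r ^ 2 * Δ) hPsum
  have e3 := Nat.mul_le_mul_left (r ^ 6) hQsum
  refine (Nat.add_le_add (Nat.add_le_add e1 e2) e3).trans (le_of_eq ?_)
  ring

end Blowup

/-! ### Two bites -/

section TwoBites

variable {V W : Type*} [Fintype W] [DecidableEq W]

/-- The images under `h` of pairs in `S` whose images under `g` have no common neighbour. -/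
def openPairs (H : SimpleGraph W) [DecidableRel H.Adj] (g h : V → W) (S : Finset V) :
    Finset (Sym2 W) :=
  {z ∈ S.offDiag | ∀ w, ¬ (H.Adj w (g z.1) ∧ H.Adj w (g z.2))}.image fun z => s(h z.1, h z.2)

theorem card_openPairs_le (H : SimpleGraph W) [DecidableRel H.Adj] (g h : V → W) (S : Finset V) :
    #(openPairs H g h S) ≤ #S ^ 2 := by
  refine Finset.card_image_le.trans ((Finset.card_filter_le _ _).trans ?_)
  rw [Finset.offDiag_card, sq]
  omega

theorem sq_card_le_card_openPairs {H : SimpleGraph W} [DecidableRel H.Adj] {g h : V → W}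
    {S : Finset V} (hh : Set.InjOn h S) :
    #S ^ 2 ≤ #S + 2 * #(openPairs H g h S) + ∑ w, blowDegree H g S w ^ 2 := by
  classical
  set O := {z ∈ S.offDiag | ∀ w, ¬ (H.Adj w (g z.1) ∧ H.Adj w (g z.2))} with hO
  have h1 : #O ≤ 2 * #(openPairs H g h S) := by
    have h2 := card_le_two_mul_card_image_sym2 (O.image (Prod.map h h))
    rw [Finset.image_image, Finset.card_image_of_injOn] at h2
    · exact h2
    · rintro ⟨u, v⟩ hz ⟨u', v'⟩ hz' he
      simp only [hO, coe_filter, mem_offDiag, Set.mem_ofPred_eq] at hz hz'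
      simp only [Prod.map_apply, Prod.mk.injEq] at he ⊢
      exact ⟨hh hz.1.1 hz'.1.1 he.1, hh hz.1.2.1 hz'.1.2.1 he.2⟩
  have h3 : S.offDiag ⊆ O ∪ univ.biUnion fun w =>
      {u ∈ S | H.Adj w (g u)} ×ˢ {u ∈ S | H.Adj w (g u)} := by
    rintro ⟨u, v⟩ hz
    simp only [hO, mem_union, mem_filter, mem_biUnion, mem_univ, true_and, mem_product]
    rw [mem_offDiag] at hz
    by_cases hw : ∀ w, ¬ (H.Adj w (g u) ∧ H.Adj w (g v))
    · exact Or.inl ⟨mem_offDiag.2 hz, hw⟩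
    · push Not at hw
      obtain ⟨w, hw⟩ := hw
      exact Or.inr ⟨w, ⟨hz.1, hw.1⟩, hz.2.1, hw.2⟩
  have h4 := (Finset.card_le_card h3).trans ((Finset.card_union_le _ _).trans
    (Nat.add_le_add_left Finset.card_biUnion_le _))
  simp only [Finset.card_product, Finset.offDiag_card, ← sq] at h4
  simp only [blowDegree]
  omega

theorem exists_cliqueFree_three_of_twoBites {X : Type*} [DecidableEq X] {B : Finset X}
    {f₁ f₂ : Sym2 W → X} {g₁ g₂ : V → W} {a c n : ℕ}
    (h₁ : ∃ H' ≤ labelGraph B f₁, H'.CliqueFree 3 ∧ ∃ D : Finset (Sym2 W),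
      (∀ u v, (labelGraph B f₁).Adj u v → ¬ H'.Adj u v → s(u, v) ∈ D) ∧
      ∀ T : Finset W, #T = a → #{e ∈ D | e ∈ T.sym2} ≤ c)
    (h₂ : ∃ H' ≤ labelGraph B f₂, H'.CliqueFree 3 ∧ ∃ D : Finset (Sym2 W),
      (∀ u v, (labelGraph B f₂).Adj u v → ¬ H'.Adj u v → s(u, v) ∈ D) ∧
      ∀ T : Finset W, #T = a → #{e ∈ D | e ∈ T.sym2} ≤ c)
    (h₁₂ : ∀ S : Finset V, #S = a → Set.InjOn g₂ S →
      c < #{e ∈ openPairs (labelGraph B f₁) g₁ g₂ S | f₂ e ∈ B})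
    (h₂₁ : ∀ S : Finset V, #S = a → Set.InjOn g₁ S →
      c < #{e ∈ openPairs (labelGraph B f₂) g₂ g₁ S | f₁ e ∈ B})
    (hn : ∀ S : Finset V, #S = n → a ≤ #(S.image g₁) ∨ a ≤ #(S.image g₂)) :
    ∃ G : SimpleGraph V, G.CliqueFree 3 ∧ Gᶜ.CliqueFree n := by
  obtain ⟨H₁, hH₁, hf₁, D₁, hD₁, hc₁⟩ := h₁
  obtain ⟨H₂, hH₂, hf₂, D₂, hD₂, hc₂⟩ := h₂
  set bite : SimpleGraph W → SimpleGraph W → (V → W) → (V → W) → V → V → Prop :=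
    fun H K g h u v => H.Adj (g u) (g v) ∧ ∀ w, ¬ (K.Adj w (h u) ∧ K.Adj w (h v)) with hbite
  have hsymm : ∀ H K g h u v, bite H K g h u v → bite H K g h v u := by
    intro H K g h u v huv
    exact ⟨huv.1.symm, fun w hw => huv.2 w hw.symm⟩
  let G : SimpleGraph V :=
    { Adj := fun u v => bite H₁ H₂ g₁ g₂ u v ∨ bite H₂ H₁ g₂ g₁ u v
      symm := ⟨fun u v h => h.imp (hsymm _ _ _ _ _ _) (hsymm _ _ _ _ _ _)⟩
      loopless := ⟨fun u h => by
        rcases h with h | h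
        · exact H₁.loopless.irrefl _ h.1
        · exact H₂.loopless.irrefl _ h.1⟩ }
  have indep : ∀ {f f' : Sym2 W → X} {H K : SimpleGraph W} {g h : V → W} {D : Finset (Sym2 W)},
      K ≤ labelGraph B f' →
      (∀ u v, (labelGraph B f).Adj u v → ¬ H.Adj u v → s(u, v) ∈ D) →
      (∀ T : Finset W, #T = a → #{e ∈ D | e ∈ T.sym2} ≤ c) →
      (∀ S : Finset V, #S = a → Set.InjOn g S →
        c < #{e ∈ openPairs (labelGraph B f') h g S | f e ∈ B}) →
      (∀ u v, bite H K g h u v → G.Adj u v) →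
      ∀ S : Finset V, Gᶜ.IsClique S → a ≤ #(S.image g) → False := by
    intro f f' H K g h D hK hD hc hR hG S hS ha
    obtain ⟨T, hT, hTc⟩ := Finset.exists_subset_card_eq ha
    obtain ⟨S', hS', hS'T, hinj⟩ : ∃ S' ⊆ S, S'.image g = T ∧ Set.InjOn g S' := by
      obtain ⟨S', hS', hbij⟩ := Set.SurjOn.exists_bijOn_subset
        (f := g) (s := (S : Set V)) (t := (T : Set W)) (by
          intro b hb
          have := hT hb
          simpa using this)
      have hfin : S'.Finite := (Finset.finite_toSet S).subset hS'
      refine ⟨hfin.toFinset, by simpa using hS', ?_, by simpa using hbij.injOn⟩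
      apply Finset.coe_injective
      simpa using hbij.image_eq
    have hcard : #S' = a := by
      rw [← hTc, ← hS'T, Finset.card_image_of_injOn hinj]
    refine absurd (hR S' hcard hinj) (not_lt.2 ((Finset.card_le_card ?_).trans (hc T hTc)))
    intro e he
    rw [mem_filter] at he
    obtain ⟨he1, he2⟩ := he
    simp only [openPairs, mem_image, mem_filter, mem_offDiag] at he1
    obtain ⟨⟨u, v⟩, ⟨⟨hu, hv, huv⟩, hop⟩, rfl⟩ := he1
    simp only at hu hv huv hop he2
    have hguv : g u ≠ g v := fun h => huv (hinj hu hv h)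
    have hnadj : ¬ G.Adj u v := (hS (hS' hu) (hS' hv) huv).2
    refine mem_filter.2 ⟨hD _ _ ⟨hguv, he2⟩ fun hadj => hnadj (hG u v ⟨hadj, fun w hw => ?_⟩), ?_⟩
    · exact hop w ⟨hK hw.1, hK hw.2⟩
    · rw [Finset.mk_mem_sym2_iff, ← hS'T]
      exact ⟨mem_image_of_mem _ hu, mem_image_of_mem _ hv⟩
  refine ⟨G, ?_, ?_⟩
  · classical
    intro s hs
    obtain ⟨u, v, w, huv, huw, hvw, rfl⟩ := is3Clique_iff.1 hs
    have key : ∀ {H K : SimpleGraph W} {g h : V → W} {x y z : V}, bite H K g h x y →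
        bite H K g h x z → bite K H h g y z → False := fun hxy hxz hyz =>
      hyz.2 _ ⟨hxy.1, hxz.1⟩
    have key' : ∀ {H K : SimpleGraph W} {g h : V → W}, H.CliqueFree 3 → bite H K g h u v →
        bite H K g h u w → bite H K g h v w → False := fun hH h1 h2 h3 =>
      hH _ (is3Clique_triple_iff.2 ⟨h1.1, h2.1, h3.1⟩)
    rcases huv with h1 | h1 <;> rcases huw with h2 | h2 <;> rcases hvw with h3 | h3
    · exact key' hf₁ h1 h2 h3
    · exact key h1 h2 h3
    · exact key (hsymm _ _ _ _ _ _ h1) h3 h2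
    · exact key (hsymm _ _ _ _ _ _ h2) (hsymm _ _ _ _ _ _ h3) h1
    · exact key (hsymm _ _ _ _ _ _ h2) (hsymm _ _ _ _ _ _ h3) h1
    · exact key (hsymm _ _ _ _ _ _ h1) h3 h2
    · exact key h1 h2 h3
    · exact key' hf₂ h1 h2 h3
  · intro S hS
    rcases hn S hS.card_eq with ha | ha
    · exact indep hH₂ hD₁ hc₁ h₂₁ (fun _ _ => Or.inl) S hS.isClique ha
    · exact indep hH₁ hD₂ hc₂ h₁₂ (fun _ _ => Or.inr) S hS.isClique ha

end TwoBites

/-! ### The second projection -/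

theorem pow_le_two_pow_mul (r j : ℕ) : (r : ℝ) ^ j ≤ 2 ^ (j * r) := by
  rw [mul_comm, pow_mul]
  gcongr
  exact_mod_cast (Nat.lt_two_pow_self (n := r)).le

theorem exp_one_le_three : Real.exp 1 ≤ 3 := by
  linarith [Real.exp_one_lt_d9]

theorem inv_pow_le_of_le {r i j : ℕ} (hr : 0 < r) (hij : i ≤ j) :
    ((r : ℝ) ^ j)⁻¹ ≤ ((r : ℝ) ^ i)⁻¹ := by
  have : (1 : ℝ) ≤ r := by exact_mod_cast hr
  gcongr

/-- A map with small fibres, under which no set of size `16 * a` collapses to fewer than `a` points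
simultaneously with the first projection. -/
theorem exists_projection {r a : ℕ} (hr : 3 ≤ r) (ha : 0 < a) (har : a ≤ r ^ 9) :
    ∃ g : Fin (r ^ 14) × Fin (r ^ 2) → Fin (r ^ 14), (∀ b, #{u | g u = b} ≤ 8 * r ^ 2) ∧
      ∀ S : Finset (Fin (r ^ 14) × Fin (r ^ 2)), #S = 16 * a →
        a ≤ #(S.image Prod.fst) ∨ a ≤ #(S.image g) := by
  classical
  have hr0 : (0 : ℝ) < r := by exact_mod_cast (by omega : 0 < r)
  have hr3 : (3 : ℝ) ≤ r := by exact_mod_cast hr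
  have : NeZero (r ^ 14) := ⟨by positivity⟩
  have haW : a ≤ Fintype.card (Fin (r ^ 14)) := by
    rw [Fintype.card_fin]
    exact har.trans (Nat.pow_le_pow_right (by omega) (by norm_num))
  set F : (Fin (r ^ 14) × Fin (r ^ 2) → Fin (r ^ 14)) → Prop :=
    fun g => ∃ b ∈ (univ : Finset (Fin (r ^ 14))), 8 * r ^ 2 ≤ #{u | g u = b} with hF
  set C : (Fin (r ^ 14) × Fin (r ^ 2) → Fin (r ^ 14)) → Prop :=
    fun g => ∃ z ∈ powersetCard a (univ : Finset (Fin (r ^ 14))) ×ˢ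
      powersetCard a (univ : Finset (Fin (r ^ 14))), ∃ S : Finset (Fin (r ^ 14) × Fin (r ^ 2)),
        #S = 16 * a ∧ S.image Prod.fst ⊆ z.1 ∧ S.image g ⊆ z.2 with hC
  have hFp : prob F ≤ 1 / 4 := by
    refine (prob_exists_le_card_mul (c := (1 / 2 : ℝ) ^ (8 * r ^ 2)) fun b _ => ?_).trans ?_
    · have h := prob_exists_disjoint_le (univ : Finset (Fin (r ^ 14) × Fin (r ^ 2)))
        (fun u => ({u} : Finset (Fin (r ^ 14) × Fin (r ^ 2)))) ({b} : Finset (Fin (r ^ 14)))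
        1 (8 * r ^ 2)
      refine (prob_mono fun g hg => ?_).trans (h.trans ?_)
      · obtain ⟨J, hJ, hc⟩ := Finset.exists_subset_card_eq hg
        refine ⟨J, subset_univ _, hc, ?_, by simp, ?_⟩
        · intro u _ v _ huv
          simp [Function.onFun, huv]
        · intro u hu e he
          rw [mem_singleton] at he ⊢
          rw [he]
          exact (mem_filter.1 (hJ hu)).2
      · refine pow_le_pow_left₀ (by positivity) ?_ _
        simp only [card_univ, Fintype.card_prod, Fintype.card_fin, card_singleton, pow_one]
        push_cast
        rw [div_le_iff₀ (by positivity)]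
        field_simp
        nlinarith [exp_one_le_three]
    · rw [card_univ, Fintype.card_fin]
      push_cast
      have h1 : (14 * r + 2 : ℕ) ≤ 8 * r ^ 2 := by nlinarith
      calc (r : ℝ) ^ 14 * (1 / 2) ^ (8 * r ^ 2) ≤ 2 ^ (14 * r) * (1 / 2) ^ (14 * r + 2) := by
            gcongr ?_ * ?_
            · exact pow_le_two_pow_mul r 14
            · exact pow_le_pow_of_le_one (by norm_num) (by norm_num) h1
        _ = 1 / 4 := by
            rw [pow_add, ← mul_assoc, ← mul_pow]; norm_num
  have hCp : prob C ≤ 1 / 4 := by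
    refine (prob_exists_le_card_mul (c := (((r : ℝ) ^ 3)⁻¹) ^ (16 * a)) fun z hz => ?_).trans ?_
    · simp only [mem_product, mem_powersetCard, subset_univ, true_and] at hz
      have h := prob_exists_disjoint_le (z.1 ×ˢ (univ : Finset (Fin (r ^ 2))))
        (fun u => ({u} : Finset (Fin (r ^ 14) × Fin (r ^ 2)))) z.2
        1 (16 * a)
      refine (prob_mono fun g hg => ?_).trans (h.trans ?_)
      · obtain ⟨S, hS, h1, h2⟩ := hg
        refine ⟨S, ?_, hS, ?_, by simp, ?_⟩
        · intro u hu
          simpa using h1 (mem_image_of_mem _ hu)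
        · intro u _ v _ huv
          simp [Function.onFun, huv]
        · intro u hu e he
          rw [mem_singleton] at he
          rw [he]
          exact h2 (mem_image_of_mem _ hu)
      · gcongr
        simp only [card_univ, card_product, Fintype.card_fin, hz.1, hz.2, pow_one]
        push_cast
        have ha' : (0 : ℝ) < a := by exact_mod_cast ha
        have har' : (a : ℝ) ≤ r ^ 9 := by exact_mod_cast har
        rw [div_le_iff₀ (by positivity)]
        field_simp
        nlinarith [exp_one_le_three, Real.exp_pos 1]
    · rw [card_product, card_powersetCard, card_univ, Fintype.card_fin]
      have h1 : (((r ^ 14).choose a : ℕ) : ℝ) ≤ ((r : ℝ) ^ 14) ^ a := by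
        exact_mod_cast Nat.choose_le_pow _ _
      push_cast
      calc _ ≤ ((r : ℝ) ^ 14) ^ a * ((r : ℝ) ^ 14) ^ a * ((r : ℝ) ^ 3)⁻¹ ^ (16 * a) := by gcongr
        _ = ((r : ℝ) ^ (20 * a))⁻¹ := by
          rw [inv_pow, ← div_eq_mul_inv, div_eq_iff (by positivity)]
          rw [eq_inv_mul_iff_mul_eq₀ (by positivity)]
          ring
        _ ≤ ((r : ℝ) ^ 2)⁻¹ := inv_pow_le_of_le (by omega) (by omega)
        _ ≤ 1 / 4 := by
          rw [one_div]
          gcongr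
          nlinarith
  obtain ⟨g, hg⟩ := exists_not_of_prob_lt_one (P := fun g => F g ∨ C g)
    (lt_of_le_of_lt ((prob_or_le F C).trans (add_le_add hFp hCp)) (by norm_num))
  simp only [not_or] at hg
  refine ⟨g, fun b => ?_, fun S hS => ?_⟩
  · by_contra! hlt
    exact hg.1 ⟨b, mem_univ _, hlt.le⟩
  · by_contra! hlt
    obtain ⟨A, hA, hAc⟩ := Finset.exists_superset_card_eq hlt.1.le haW
    obtain ⟨A', hAS, hAc'⟩ := Finset.exists_superset_card_eq hlt.2.le haW
    exact hg.2 ⟨(A, A'), by simp [hAc, hAc'], S, hS, hA, hAS⟩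

/-! ### Typical random graphs -/

/-- The first `ℓ` labels. -/
def lowLabels (s ℓ : ℕ) : Finset (Fin s) := {x | x.val < ℓ}

theorem card_lowLabels {s ℓ : ℕ} (h : ℓ ≤ s) : #(lowLabels s ℓ) = ℓ := by
  rw [lowLabels, Fin.card_filter_val_lt, min_eq_right h]

section Typical

variable {r ℓ : ℕ}

/-- The label graph has a vertex of large degree, a pair of large codegree, a dense pair of sets,
or many disjoint triangles meeting a small set. -/
def AtypicalLabels (r ℓ : ℕ) (f : Sym2 (Fin (r ^ 14)) → Fin (r ^ 8)) : Prop :=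
  (∃ v, 8 * ℓ * r ^ 6 ≤ #{b | (labelGraph (lowLabels (r ^ 8) ℓ) f).Adj v b}) ∨
  (∃ u v, u ≠ v ∧ 30 ≤ #{c | (labelGraph (lowLabels (r ^ 8) ℓ) f).Adj u c ∧
    (labelGraph (lowLabels (r ^ 8) ℓ) f).Adj v c}) ∨
  (∃ A C : Finset (Fin (r ^ 14)), #A = 100000 * ℓ * r ^ 8 ∧ #C = 100000 * ℓ * r ^ 7 ∧
    2 * (60 * (100000 * ℓ * r ^ 8)) ≤
      ∑ v ∈ A, #{b ∈ C | (labelGraph (lowLabels (r ^ 8) ℓ) f).Adj v b}) ∨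
  (∃ T : Finset (Fin (r ^ 14)), #T = 100000 * ℓ * r ^ 8 ∧
    ∃ J : Finset (Fin (r ^ 14) × Fin (r ^ 14) × Fin (r ^ 14)), #J = 30 * (100000 * ℓ * r ^ 8) ∧
      (J : Set (Fin (r ^ 14) × Fin (r ^ 14) × Fin (r ^ 14))).PairwiseDisjoint triEdges ∧
      ∀ z ∈ J, #(triEdges z) = 3 ∧ (∃ e ∈ triEdges z, e ∈ T.sym2) ∧
        ∀ e ∈ triEdges z, f e ∈ lowLabels (r ^ 8) ℓ)

theorem prob_atypicalLabels_lt (hℓ : 1 ≤ ℓ) (hr : 10000000000 * ℓ ^ 8 ≤ r) :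
    prob (AtypicalLabels r ℓ) < 1 / 4 := by
  have hℓ8 : 1 ≤ ℓ ^ 8 := Nat.one_le_pow _ _ hℓ
  have hr1 : 10000000000 ≤ r := by omega
  have : NeZero (r ^ 8) := ⟨by positivity⟩
  have hr0 : (0 : ℝ) < r := by exact_mod_cast (by omega : 0 < r)
  have hr1' : (10000000000 : ℝ) ≤ r := by exact_mod_cast hr1
  have hℓ0 : (1 : ℝ) ≤ ℓ := by exact_mod_cast hℓ
  have hrℓ : (10000000000 : ℝ) * ℓ ^ 8 ≤ r := by exact_mod_cast hr
  have hpow : ∀ i, i ≤ 8 → (ℓ : ℝ) ^ i ≤ ℓ ^ 8 := fun i hi => pow_le_pow_right₀ hℓ0 hi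
  have hcard : ((#(lowLabels (r ^ 8) ℓ) : ℕ) : ℝ) / Fintype.card (Fin (r ^ 8)) = ℓ / (r : ℝ) ^ 8 := by
    rw [card_lowLabels, Fintype.card_fin]
    · push_cast; rfl
    · calc ℓ ≤ ℓ ^ 8 := Nat.le_self_pow (by norm_num) _
        _ ≤ r := by omega
        _ ≤ r ^ 8 := Nat.le_self_pow (by norm_num) _
  have hsq : ((r : ℝ) ^ 2)⁻¹ ≤ 1 / 100 := by
    rw [one_div]; gcongr; nlinarith
  have e3 := exp_one_le_three
  have e0 := Real.exp_pos 1
  have p1 : prob (fun f : Sym2 (Fin (r ^ 14)) → Fin (r ^ 8) => ∃ v, 8 * ℓ * r ^ 6 ≤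
      #{b | (labelGraph (lowLabels (r ^ 8) ℓ) f).Adj v b}) ≤ 1 / 32 := by
    refine (prob_exists_degree_ge_le _ _).trans ?_
    rw [hcard, Fintype.card_fin]
    have h1 : 14 * r + 5 ≤ 8 * ℓ * r ^ 6 := by
      calc 14 * r + 5 ≤ 8 * 1 * r ^ 2 := by nlinarith
        _ ≤ 8 * ℓ * r ^ 6 := by gcongr <;> omega
    calc _ ≤ (2 : ℝ) ^ (14 * r) * (1 / 2) ^ (8 * ℓ * r ^ 6) := by
          refine mul_le_mul (by exact_mod_cast pow_le_two_pow_mul r 14)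
            (pow_le_pow_left₀ (by positivity) ?_ _) (by positivity) (by positivity)
          push_cast
          rw [div_le_iff₀ (by positivity)]
          field_simp
          nlinarith
      _ ≤ (2 : ℝ) ^ (14 * r) * (1 / 2) ^ (14 * r + 5) := by
          gcongr ?_ * ?_
          exact pow_le_pow_of_le_one (by norm_num) (by norm_num) h1
      _ = 1 / 32 := by rw [pow_add, ← mul_assoc, ← mul_pow]; norm_num
  have p2 : prob (fun f : Sym2 (Fin (r ^ 14)) → Fin (r ^ 8) => ∃ u v, u ≠ v ∧
      30 ≤ #{c | (labelGraph (lowLabels (r ^ 8) ℓ) f).Adj u c ∧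
        (labelGraph (lowLabels (r ^ 8) ℓ) f).Adj v c}) ≤ 1 / 100 := by
    refine (prob_exists_codegree_ge_le _ _).trans (le_trans ?_ hsq)
    rw [hcard, Fintype.card_fin]
    push_cast
    have h2 : (ℓ : ℝ) ^ 2 ≤ r := by have := hpow 2 (by norm_num); nlinarith
    calc _ ≤ ((r : ℝ) ^ 14) ^ 2 * ((r : ℝ)⁻¹) ^ 30 := by
          gcongr
          rw [div_le_iff₀ (by positivity)]
          field_simp
          nlinarith
      _ = _ := by field_simp
  have p3 : prob (fun f : Sym2 (Fin (r ^ 14)) → Fin (r ^ 8) => ∃ A C : Finset (Fin (r ^ 14)),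
      #A = 100000 * ℓ * r ^ 8 ∧ #C = 100000 * ℓ * r ^ 7 ∧ 2 * (60 * (100000 * ℓ * r ^ 8)) ≤
      ∑ v ∈ A, #{b ∈ C | (labelGraph (lowLabels (r ^ 8) ℓ) f).Adj v b}) ≤ 1 / 100 := by
    refine (prob_exists_edges_ge_le _ _ _ _).trans (le_trans ?_ hsq)
    rw [hcard, Fintype.card_fin]
    set a := 100000 * ℓ * r ^ 8 with ha
    have ha1 : 1 ≤ a := by rw [ha]; exact Nat.succ_le_of_lt (by positivity)
    have haa : a + 100000 * ℓ * r ^ 7 ≤ 2 * a := by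
      have : 100000 * ℓ * r ^ 7 ≤ 100000 * ℓ * r ^ 8 := by gcongr <;> omega
      omega
    have h4 : (100000 * (ℓ : ℝ) ^ 2) ^ 2 ≤ r := by have := hpow 4 (by norm_num); nlinarith
    have hbase : Real.exp 1 * ((a : ℕ) * ((100000 * ℓ * r ^ 7 : ℕ) : ℝ)) * (ℓ / (r : ℝ) ^ 8) /
        ((60 * a : ℕ) : ℝ) ≤ 100000 * (ℓ : ℝ) ^ 2 / r := by
      have ha0 : (0 : ℝ) < a := by exact_mod_cast ha1
      push_cast
      rw [div_le_iff₀ (by positivity)]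
      field_simp
      nlinarith [sq_nonneg (ℓ : ℝ)]
    have hsqb : (100000 * (ℓ : ℝ) ^ 2 / r) ^ 2 ≤ (r : ℝ)⁻¹ := by
      rw [div_pow, div_le_iff₀ (by positivity)]
      field_simp
      exact le_trans (le_of_eq (by ring)) h4
    calc _ ≤ ((r : ℝ) ^ 14) ^ (2 * a) * (100000 * (ℓ : ℝ) ^ 2 / r) ^ (60 * a) := by
          push_cast at hbase ⊢
          gcongr
          · exact one_le_pow₀ (by linarith)
      _ = ((r : ℝ) ^ 14) ^ (2 * a) * ((100000 * (ℓ : ℝ) ^ 2 / r) ^ 2) ^ (30 * a) := by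
          rw [← pow_mul _ 2]; congr 2; ring
      _ ≤ ((r : ℝ) ^ 14) ^ (2 * a) * ((r : ℝ)⁻¹) ^ (30 * a) := by gcongr
      _ = ((r : ℝ) ^ (2 * a))⁻¹ := by
          rw [inv_pow, ← div_eq_mul_inv, div_eq_iff (by positivity),
            eq_inv_mul_iff_mul_eq₀ (by positivity)]
          ring
      _ ≤ _ := inv_pow_le_of_le (by omega) (by omega)
  have p4 : prob (fun f : Sym2 (Fin (r ^ 14)) → Fin (r ^ 8) => ∃ T : Finset (Fin (r ^ 14)),
      #T = 100000 * ℓ * r ^ 8 ∧ ∃ J : Finset (Fin (r ^ 14) × Fin (r ^ 14) × Fin (r ^ 14)),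
        #J = 30 * (100000 * ℓ * r ^ 8) ∧
      (J : Set (Fin (r ^ 14) × Fin (r ^ 14) × Fin (r ^ 14))).PairwiseDisjoint triEdges ∧
      ∀ z ∈ J, #(triEdges z) = 3 ∧ (∃ e ∈ triEdges z, e ∈ T.sym2) ∧
        ∀ e ∈ triEdges z, f e ∈ lowLabels (r ^ 8) ℓ) ≤ 1 / 100 := by
    refine (prob_exists_triangles_ge_le _ _ _).trans (le_trans ?_ hsq)
    rw [hcard, Fintype.card_fin]
    set a := 100000 * ℓ * r ^ 8 with ha
    have ha1 : 1 ≤ a := by rw [ha]; exact Nat.succ_le_of_lt (by positivity)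
    have h4 : 100000 * (ℓ : ℝ) ^ 4 ≤ r := by have := hpow 4 (by norm_num); nlinarith
    have hbase : Real.exp 1 * (3 * ((a : ℝ) ^ 2 * ((r ^ 14 : ℕ) : ℝ))) * (ℓ / (r : ℝ) ^ 8) ^ 3 /
        ((30 * a : ℕ) : ℝ) ≤ (r : ℝ)⁻¹ := by
      have ha0 : (0 : ℝ) < a := by exact_mod_cast ha1
      have ha2 : (a : ℝ) = 100000 * ℓ * r ^ 8 := by rw [ha]; push_cast; ring
      push_cast
      rw [div_le_iff₀ (by positivity)]
      field_simp
      rw [ha2]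
      have h5 : Real.exp 1 * 3 * (100000 * (ℓ : ℝ) ^ 4) ≤ 30 * r := by nlinarith
      calc _ = Real.exp 1 * 3 * (100000 * (ℓ : ℝ) ^ 4) * r ^ 8 := by ring
        _ ≤ 30 * r * r ^ 8 := by gcongr
        _ = _ := by ring
    calc _ ≤ ((r : ℝ) ^ 14) ^ a * ((r : ℝ)⁻¹) ^ (30 * a) := by
          push_cast at hbase ⊢
          gcongr
      _ = ((r : ℝ) ^ (16 * a))⁻¹ := by
          rw [inv_pow, ← div_eq_mul_inv, div_eq_iff (by positivity),
            eq_inv_mul_iff_mul_eq₀ (by positivity)]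
          ring
      _ ≤ _ := inv_pow_le_of_le (by omega) (by omega)
  have q := (prob_or_le _ _).trans (add_le_add p1 ((prob_or_le _ _).trans
    (add_le_add p2 ((prob_or_le _ _).trans (add_le_add p3 p4)))))
  exact lt_of_le_of_lt q (by norm_num)

theorem sq_le_four_mul_card_openPairs (hℓ : 1 ≤ ℓ) (hr : 10000000000 * ℓ ^ 8 ≤ r) {V : Type*}
    [DecidableEq V] {g h : V → Fin (r ^ 14)} (hfib : ∀ (S : Finset V) b, #{u ∈ S | g u = b} ≤ 8 * r ^ 2)
    {f : Sym2 (Fin (r ^ 14)) → Fin (r ^ 8)} (hf : ¬ AtypicalLabels r ℓ f) {S : Finset V}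
    (hS : #S = 100000 * ℓ * r ^ 8) (hh : Set.InjOn h S) :
    #S ^ 2 ≤ 4 * #(openPairs (labelGraph (lowLabels (r ^ 8) ℓ) f) g h S) := by
  have hℓ8 : ℓ ≤ ℓ ^ 8 := Nat.le_self_pow (by norm_num) _
  have hr1 : 10000000000 ≤ r := by omega
  have hℓr : 100000 * ℓ + 241 ≤ r := by omega
  simp only [AtypicalLabels, not_or] at hf
  obtain ⟨hdeg, hcod, hedge, -⟩ := hf
  have h1 := sum_sq_blowDegree_le (H := labelGraph (lowLabels (r ^ 8) ℓ) f) (g := g) (S := S)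
    (a := 100000 * ℓ * r ^ 8) (a' := 100000 * ℓ * r ^ 7) (r := r) (Δ := 8 * ℓ * r ^ 6) (K := 120)
    (κ := 30) (fun v => by
      by_contra! hlt
      exact hdeg ⟨v, hlt.le⟩) (fun u v huv => by
      by_contra! hlt
      exact hcod ⟨u, v, huv, hlt.le⟩) (fun A C hA hC => by
      by_contra! hlt
      exact hedge ⟨A, C, hA, hC, le_trans (by omega) hlt.le⟩) (hfib S) hS (by ring) (by omega)
    (by positivity) (by
      rw [Fintype.card_fin]
      calc 100000 * ℓ * r ^ 8 ≤ r * r ^ 8 := by gcongr; omega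
        _ = r ^ 9 := by ring
        _ ≤ r ^ 14 := Nat.pow_le_pow_right (by omega) (by norm_num))
    (by
      have hr8 : 0 < r ^ 8 := by positivity
      have := Nat.mul_le_mul_right (r ^ 8) hℓr
      calc _ < (100000 * ℓ + 241) * r ^ 8 := by linarith
        _ ≤ r * r ^ 8 := this
        _ = r ^ 9 := by ring)
    (Nat.mul_le_mul_right _ (by omega))
  have h2 := sq_card_le_card_openPairs (H := labelGraph (lowLabels (r ^ 8) ℓ) f) (g := g) hh
  have h3 : 9 * 120 * r ^ 2 * (100000 * ℓ * r ^ 8 * (8 * ℓ * r ^ 6)) +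
      16 * r ^ 2 * (8 * ℓ * r ^ 6) * (100000 * ℓ * r ^ 8) +
      18 * r ^ 8 * 120 * (100000 * ℓ * r ^ 8) + 100000 * ℓ * r ^ 8 ≤
      50000 * ℓ * r ^ 8 * (100000 * ℓ * r ^ 8) := by
    have h4 : 1 ≤ ℓ * r ^ 8 := Nat.succ_le_of_lt (by positivity)
    have h5 : r ^ 8 ≤ ℓ * r ^ 8 := Nat.le_mul_of_pos_left _ hℓ
    calc _ = (8768 * (ℓ * r ^ 8) + 2160 * r ^ 8 + 1) * (100000 * ℓ * r ^ 8) := by ring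
      _ ≤ (50000 * (ℓ * r ^ 8)) * (100000 * ℓ * r ^ 8) := by gcongr; omega
      _ = _ := by ring
  rw [hS] at h2 ⊢
  have h6 : (100000 * ℓ * r ^ 8) ^ 2 = 2 * (50000 * ℓ * r ^ 8 * (100000 * ℓ * r ^ 8)) := by ring
  omega

theorem prob_exists_few_openPairs_lt (hℓ : 1 ≤ ℓ) (hr : 10000000000 * ℓ ^ 8 ≤ r)
    (hlog : Real.log r ≤ ℓ ^ 2) {g h : Fin (r ^ 14) × Fin (r ^ 2) → Fin (r ^ 14)}
    (hfib : ∀ b, #{u | g u = b} ≤ 8 * r ^ 2)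
    {f : Sym2 (Fin (r ^ 14)) → Fin (r ^ 8)} (hf : ¬ AtypicalLabels r ℓ f) :
    prob (fun f' : Sym2 (Fin (r ^ 14)) → Fin (r ^ 8) =>
      ∃ S : Finset (Fin (r ^ 14) × Fin (r ^ 2)), #S = 100000 * ℓ * r ^ 8 ∧ Set.InjOn h S ∧
        #{e ∈ openPairs (labelGraph (lowLabels (r ^ 8) ℓ) f) g h S |
          f' e ∈ lowLabels (r ^ 8) ℓ} ≤ 3 * (30 * (100000 * ℓ * r ^ 8))) < 1 / 4 := by
  have hℓ8 : ℓ ≤ ℓ ^ 8 := Nat.le_self_pow (by norm_num) _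
  have hr1 : 10000000000 ≤ r := by omega
  have : NeZero (r ^ 8) := ⟨by positivity⟩
  have hr0 : (0 : ℝ) < r := by exact_mod_cast (by omega : 0 < r)
  have hℓ1 : (1 : ℝ) ≤ ℓ := by exact_mod_cast hℓ
  have hℓr : 100000 * ℓ ≤ r := by omega
  set a := 100000 * ℓ * r ^ 8 with ha
  have hr8 : 10000000000 ≤ r ^ 8 := hr1.trans (Nat.le_self_pow (by norm_num) _)
  have ha1 : 1000 ≤ a := by rw [ha]; nlinarith
  have ha0 : (0 : ℝ) < a := by exact_mod_cast (by omega : 0 < a)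
  have har : (a : ℝ) ≤ (r : ℝ) ^ 9 := by
    exact_mod_cast (show a ≤ r ^ 9 by
      calc a ≤ r * r ^ 8 := by rw [ha]; gcongr
        _ = r ^ 9 := by ring)
  have hp1 : (ℓ : ℝ) / (r : ℝ) ^ 8 ≤ 1 := by
    rw [div_le_one (by positivity)]
    exact_mod_cast (show ℓ ≤ r ^ 8 from le_trans (by omega) (Nat.le_self_pow (by norm_num) r))
  have hcard : ((#(lowLabels (r ^ 8) ℓ) : ℕ) : ℝ) / Fintype.card (Fin (r ^ 8)) = ℓ / (r : ℝ) ^ 8 := by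
    rw [card_lowLabels, Fintype.card_fin]
    · push_cast; rfl
    · exact le_trans (by omega) (Nat.le_self_pow (by norm_num) r)
  refine lt_of_le_of_lt (b := (#(powersetCard a (univ : Finset (Fin (r ^ 14) × Fin (r ^ 2)))) : ℝ) *
    (((r : ℝ) ^ 9) ^ (180 * a) * Real.exp (-((ℓ : ℝ) / (r : ℝ) ^ 8) * ((a : ℝ) ^ 2 / 4 - 90 * a))))
    ((prob_mono (Q := fun f' => ∃ S ∈ powersetCard a (univ : Finset (Fin (r ^ 14) × Fin (r ^ 2))),
      Set.InjOn h S ∧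
        #{e ∈ openPairs (labelGraph (lowLabels (r ^ 8) ℓ) f) g h S |
          f' e ∈ lowLabels (r ^ 8) ℓ} ≤ 3 * (30 * a)) ?_).trans
      (prob_exists_le_card_mul fun S hS => ?_)) ?_
  · rintro f' ⟨S, hS, h1⟩
    exact ⟨S, by simp [hS], h1⟩
  · have hSc : #S = a := (mem_powersetCard.1 hS).2
    by_cases hinj : Set.InjOn h S
    swap
    · refine (prob_mono (Q := fun _ => False) (by tauto)).trans ?_
      simp only [prob, filter_false, card_empty, Nat.cast_zero, zero_div]
      positivity
    set Y := openPairs (labelGraph (lowLabels (r ^ 8) ℓ) f) g h S with hY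
    have hY1 : a ^ 2 ≤ 4 * #Y := hSc ▸ sq_le_four_mul_card_openPairs hℓ hr (fun S b =>
      (card_le_card (filter_subset_filter _ (subset_univ S))).trans (hfib b)) hf hSc hinj
    have hY2 : #Y ≤ a ^ 2 := hSc ▸ card_openPairs_le _ g h S
    have hY3 : 3 * (30 * a) ≤ #Y := by nlinarith
    have h1 := prob_card_le_le Y (lowLabels (r ^ 8) ℓ) hY3
    refine (prob_mono fun f' hf' => ?_).trans (h1.trans ?_)
    · exact hf'.2
    rw [hcard]
    have hY1' : (a : ℝ) ^ 2 / 4 ≤ #Y := by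
      have : (a : ℝ) ^ 2 ≤ 4 * #Y := by exact_mod_cast hY1
      linarith
    have hY2' : ((#Y : ℕ) : ℝ) ≤ (a : ℝ) ^ 2 := by exact_mod_cast hY2
    refine mul_le_mul ?_ ?_ (by positivity) (by positivity)
    · calc ((#Y : ℕ) : ℝ) ^ (3 * (30 * a)) ≤ ((a : ℝ) ^ 2) ^ (3 * (30 * a)) := by gcongr
        _ = (a : ℝ) ^ (180 * a) := by rw [← pow_mul]; congr 1; ring
        _ ≤ _ := by gcongr
    · rw [Real.exp_le_exp, neg_mul, neg_mul, neg_le_neg_iff]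
      push_cast
      refine mul_le_mul_of_nonneg_left ?_ (by positivity)
      linarith
  · rw [card_powersetCard, card_univ, Fintype.card_prod, Fintype.card_fin, Fintype.card_fin]
    have hc : (((r ^ 14 * r ^ 2).choose a : ℕ) : ℝ) ≤ ((r : ℝ) ^ 16) ^ a := by
      have := Nat.choose_le_pow (r ^ 14 * r ^ 2) a
      rw [← pow_add] at this ⊢
      exact_mod_cast this
    have hrexp : (r : ℝ) = Real.exp (Real.log r) := (Real.exp_log hr0).symm
    have hpow : ((r : ℝ) ^ 16) ^ a * ((r : ℝ) ^ 9) ^ (180 * a) =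
        Real.exp (1636 * a * Real.log r) := by
      rw [← pow_mul, ← pow_mul, ← pow_add]
      nth_rewrite 1 [hrexp]
      rw [← Real.exp_nat_mul]
      push_cast
      congr 1; ring
    have hpa : (ℓ : ℝ) / (r : ℝ) ^ 8 * a = 100000 * (ℓ : ℝ) ^ 2 := by
      rw [ha]; push_cast; field_simp
    calc _ ≤ ((r : ℝ) ^ 16) ^ a * (((r : ℝ) ^ 9) ^ (180 * a) *
          Real.exp (-((ℓ : ℝ) / (r : ℝ) ^ 8) * ((a : ℝ) ^ 2 / 4 - 90 * a))) := by gcongr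
      _ = Real.exp (1636 * a * Real.log r +
          -((ℓ : ℝ) / (r : ℝ) ^ 8) * ((a : ℝ) ^ 2 / 4 - 90 * a)) := by
          rw [← mul_assoc, hpow, Real.exp_add]
      _ ≤ Real.exp (-2) := by
          rw [Real.exp_le_exp]
          have e1 : -((ℓ : ℝ) / (r : ℝ) ^ 8) * ((a : ℝ) ^ 2 / 4 - 90 * a) =
              -(25000 * (ℓ : ℝ) ^ 2 * a) + 90 * (ℓ / (r : ℝ) ^ 8) * a := by
            linear_combination (-(a : ℝ) / 4) * hpa
          rw [e1]
          have e2 : 1636 * a * Real.log r ≤ 1636 * a * (ℓ : ℝ) ^ 2 := by gcongr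
          have e3 : 90 * (ℓ / (r : ℝ) ^ 8) * a ≤ 90 * 1 * a := by gcongr
          have e4 : (a : ℝ) * 1 ≤ a * (ℓ : ℝ) ^ 2 := by gcongr; nlinarith
          have e5 : (1000 : ℝ) ≤ a := by exact_mod_cast ha1
          linarith
      _ < 1 / 4 := by
          rw [Real.exp_neg, one_div]
          gcongr
          have := Real.add_one_lt_exp (x := 1) (by norm_num)
          have h2 : Real.exp 2 = Real.exp 1 * Real.exp 1 := by rw [← Real.exp_add]; norm_num
          rw [h2]; nlinarith

/-- Triangle-free graphs on `r ^ 16` vertices without large independent sets. -/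
theorem exists_cliqueFree_three (hℓ : 1 ≤ ℓ) (hr : 10000000000 * ℓ ^ 8 ≤ r)
    (hlog : Real.log r ≤ ℓ ^ 2) :
    ∃ G : SimpleGraph (Fin (r ^ 14) × Fin (r ^ 2)), G.CliqueFree 3 ∧
      Gᶜ.CliqueFree (16 * (100000 * ℓ * r ^ 8)) := by
  have hℓ8 : ℓ ≤ ℓ ^ 8 := Nat.le_self_pow (by norm_num) _
  have hrpos : 0 < r := by omega
  have : NeZero (r ^ 8) := ⟨by positivity⟩
  obtain ⟨g, hg1, hg2⟩ := exists_projection (r := r) (a := 100000 * ℓ * r ^ 8) (by omega)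
    (by positivity) (by
      calc 100000 * ℓ * r ^ 8 ≤ r * r ^ 8 := by gcongr; omega
        _ = r ^ 9 := by ring)
  have hfst : ∀ b, #{u : Fin (r ^ 14) × Fin (r ^ 2) | u.1 = b} ≤ 8 * r ^ 2 := by
    intro b
    calc _ ≤ #(({b} : Finset (Fin (r ^ 14))) ×ˢ (univ : Finset (Fin (r ^ 2)))) :=
          card_le_card fun u => by simp +contextual [Prod.ext_iff]
      _ ≤ 8 * r ^ 2 := by simp; omega
  obtain ⟨f₁, f₂, h₁, h₂, h₁₂, h₂₁⟩ := exists_pair_of_prob_lt (prob_atypicalLabels_lt hℓ hr)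
    (fun f hf => prob_exists_few_openPairs_lt hℓ hr hlog (g := Prod.fst) (h := g) hfst hf)
    (fun f hf => prob_exists_few_openPairs_lt hℓ hr hlog (g := g) (h := Prod.fst) hg1 hf)
  have hgood : ∀ f : Sym2 (Fin (r ^ 14)) → Fin (r ^ 8), ¬ AtypicalLabels r ℓ f →
      ∃ H' ≤ labelGraph (lowLabels (r ^ 8) ℓ) f, H'.CliqueFree 3 ∧
      ∃ D : Finset (Sym2 (Fin (r ^ 14))),
      (∀ u v, (labelGraph (lowLabels (r ^ 8) ℓ) f).Adj u v → ¬ H'.Adj u v → s(u, v) ∈ D) ∧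
      ∀ T : Finset (Fin (r ^ 14)), #T = 100000 * ℓ * r ^ 8 →
        #{e ∈ D | e ∈ T.sym2} ≤ 3 * (30 * (100000 * ℓ * r ^ 8)) := by
    intro f hf
    refine exists_cliqueFree_three_of_forall_disjoint _ fun T hT J hJ hz hJc => hf ?_
    refine Or.inr (Or.inr (Or.inr ⟨T, hT, J, hJc, hJ, fun z hzJ => ?_⟩))
    refine ⟨(hz z hzJ).1, (hz z hzJ).2.1, fun e he => ?_⟩
    have := (hz z hzJ).2.2 e he
    induction e with
    | h u v => exact (SimpleGraph.mem_edgeSet _).1 this |>.2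
  refine exists_cliqueFree_three_of_twoBites (hgood f₁ h₁) (hgood f₂ h₂) ?_ ?_ hg2
  · intro S hS hinj
    by_contra! hlt
    exact h₁₂ ⟨S, hS, hinj, hlt⟩
  · intro S hS hinj
    by_contra! hlt
    exact h₂₁ ⟨S, hS, hinj, hlt⟩

end Typical

/-! ### Cliques of size twenty -/

theorem mul_pred_le_two_mul_card_edges {α : Type*} [DecidableEq α] (T : Finset α) :
    #T * (#T - 1) ≤ 2 * #(T.offDiag.image fun z => s(z.1, z.2)) := by
  refine le_trans (le_of_eq ?_) (card_le_two_mul_card_image_sym2 _)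
  rw [Finset.offDiag_card, Nat.mul_sub, mul_one]

/-- Graphs on `M ^ 9` vertices without cliques of size `20` or independent sets of size `M ^ 2`. -/
theorem exists_cliqueFree_twenty {M : ℕ} (hM : 100 ≤ M) (hlog : 40 * Real.log M ≤ M) :
    ∃ G : SimpleGraph (Fin (M ^ 9)), G.CliqueFree 20 ∧ Gᶜ.CliqueFree (M ^ 2) := by
  classical
  have : NeZero M := ⟨by omega⟩
  have hM0 : (0 : ℝ) < M := by exact_mod_cast (by omega : 0 < M)
  have hM1 : (100 : ℝ) ≤ M := by exact_mod_cast hM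
  have hcard : ((#(lowLabels M 1) : ℕ) : ℝ) / Fintype.card (Fin M) = (M : ℝ)⁻¹ := by
    rw [card_lowLabels (by omega), Fintype.card_fin]; simp
  have hsq : ((M : ℝ) ^ 2)⁻¹ ≤ 1 / 100 := by
    rw [one_div]; gcongr; nlinarith
  have p1 : prob (fun f : Sym2 (Fin (M ^ 9)) → Fin M =>
      ∃ T ∈ powersetCard 20 (univ : Finset (Fin (M ^ 9))),
        ∀ e ∈ T.offDiag.image fun z => s(z.1, z.2), f e ∈ lowLabels M 1) ≤ 1 / 100 := by
    refine (prob_exists_le_card_mul (c := ((M : ℝ)⁻¹) ^ 190) fun T hT => ?_).trans (le_trans ?_ hsq)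
    · rw [prob_forall_mem, hcard]
      have h := mul_pred_le_two_mul_card_edges T
      rw [(mem_powersetCard.1 hT).2] at h
      exact pow_le_pow_of_le_one (by positivity) (inv_le_one_of_one_le₀ (by linarith)) (by omega)
    · rw [card_powersetCard, card_univ, Fintype.card_fin]
      have h1 : (((M ^ 9).choose 20 : ℕ) : ℝ) ≤ ((M : ℝ) ^ 9) ^ 20 := by
        exact_mod_cast Nat.choose_le_pow _ _
      calc _ ≤ ((M : ℝ) ^ 9) ^ 20 * ((M : ℝ)⁻¹) ^ 190 := by gcongr
        _ = ((M : ℝ) ^ 10)⁻¹ := by field_simp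
        _ ≤ _ := inv_pow_le_of_le (by omega) (by omega)
  have p2 : prob (fun f : Sym2 (Fin (M ^ 9)) → Fin M =>
      ∃ T ∈ powersetCard (M ^ 2) (univ : Finset (Fin (M ^ 9))),
        #{e ∈ T.offDiag.image fun z => s(z.1, z.2) | f e ∈ lowLabels M 1} ≤ 0) ≤ 1 / 2 := by
    refine (prob_exists_le_card_mul (c := Real.exp (-((M : ℝ) ^ 3 / 4))) fun T hT => ?_).trans ?_
    · refine (prob_card_le_le _ _ (Nat.zero_le _)).trans ?_
      rw [hcard, pow_zero, one_mul, Real.exp_le_exp]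
      have h := mul_pred_le_two_mul_card_edges T
      rw [(mem_powersetCard.1 hT).2] at h
      set Y := T.offDiag.image fun z => s(z.1, z.2)
      have h2 : M ^ 2 ≤ 2 * (M ^ 2 - 1) := by
        have : 2 ≤ M ^ 2 := by nlinarith
        omega
      have h3 : M ^ 2 * M ^ 2 ≤ 4 * #Y := by nlinarith
      have h4 : (M : ℝ) ^ 2 * (M : ℝ) ^ 2 ≤ 4 * #Y := by exact_mod_cast h3
      rw [neg_mul, neg_le_neg_iff, Nat.cast_zero, sub_zero, inv_mul_eq_div, le_div_iff₀ hM0]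
      nlinarith
    · rw [card_powersetCard, card_univ, Fintype.card_fin]
      have h1 : (((M ^ 9).choose (M ^ 2) : ℕ) : ℝ) ≤ ((M : ℝ) ^ 9) ^ (M ^ 2) := by
        exact_mod_cast Nat.choose_le_pow _ _
      have h2 : ((M : ℝ) ^ 9) ^ (M ^ 2) = Real.exp (9 * (M : ℝ) ^ 2 * Real.log M) := by
        rw [← pow_mul]
        nth_rewrite 1 [← Real.exp_log hM0]
        rw [← Real.exp_nat_mul]
        push_cast
        rfl
      calc _ ≤ ((M : ℝ) ^ 9) ^ (M ^ 2) * Real.exp (-((M : ℝ) ^ 3 / 4)) := by gcongr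
        _ = Real.exp (9 * (M : ℝ) ^ 2 * Real.log M + -((M : ℝ) ^ 3 / 4)) := by
          rw [h2, Real.exp_add]
        _ ≤ Real.exp (-1) := by
          rw [Real.exp_le_exp]
          have h3 : (M : ℝ) ^ 2 * (40 * Real.log M) ≤ (M : ℝ) ^ 2 * M := by gcongr
          have h4 : (100 : ℝ) ^ 3 ≤ (M : ℝ) ^ 3 := by gcongr
          nlinarith
        _ ≤ 1 / 2 := by
          rw [Real.exp_neg, one_div]
          gcongr
          linarith [Real.exp_one_gt_d9]
  obtain ⟨f, hf⟩ := exists_not_of_prob_lt_one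
    (lt_of_le_of_lt ((prob_or_le _ _).trans (add_le_add p1 p2)) (by norm_num))
  simp only [not_or] at hf
  refine ⟨labelGraph (lowLabels M 1) f, fun T hT => hf.1 ⟨T, by simp [hT.card_eq], ?_⟩,
    fun T hT => hf.2 ⟨T, by simp [hT.card_eq], ?_⟩⟩
  · simp only [mem_image, mem_offDiag]
    rintro e ⟨⟨u, v⟩, ⟨hu, hv, huv⟩, rfl⟩
    exact (hT.isClique hu hv huv).2
  · rw [Nat.le_zero, card_eq_zero, filter_eq_empty_iff]
    simp only [mem_image, mem_offDiag]
    rintro e ⟨⟨u, v⟩, ⟨hu, hv, huv⟩, rfl⟩ h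
    exact (hT.isClique hu hv huv).2 ⟨huv, h⟩

/-! ### Counting -/

theorem card_lt_ramsey {V : Type*} [Fintype V] {G : SimpleGraph V} {k n : ℕ} (hk : G.CliqueFree k)
    (hn : Gᶜ.CliqueFree n) (h0 : ramsey k n ≠ 0) : Fintype.card V < ramsey k n := by
  by_contra! hle
  have hmem : ramsey k n ∈ {N : ℕ | 0 < N ∧ ∀ G : SimpleGraph (Fin N),
      (∃ s : Finset (Fin N), G.IsNClique k s) ∨ (∃ s : Finset (Fin N), Gᶜ.IsNClique n s)} :=
    Nat.sInf_mem (Nat.nonempty_of_pos_sInf (Nat.pos_of_ne_zero h0))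
  obtain ⟨φ⟩ : Nonempty (Fin (ramsey k n) ↪ V) :=
    Function.Embedding.nonempty_of_card_le (by rwa [Fintype.card_fin])
  rcases hmem.2 (G.comap φ) with ⟨s, hs⟩ | ⟨s, hs⟩
  · exact (hk.comap ⟨(SimpleGraph.Embedding.comap φ G).toCopy⟩) s hs
  · have : (G.comap φ)ᶜ = Gᶜ.comap φ := by
      ext u v
      simp [SimpleGraph.compl_adj, φ.injective.ne_iff]
    rw [this] at hs
    exact (hn.comap ⟨(SimpleGraph.Embedding.comap φ Gᶜ).toCopy⟩) s hs

/-- The counting argument: rows below `20` are controlled by `L`, the others by `T`. -/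
theorem ramseyCount_le {x : ℝ} {V W : Type*} [Fintype V] [Fintype W] {G : SimpleGraph V}
    {H : SimpleGraph W} {L T : ℕ} (hG : G.CliqueFree 3) (hG' : Gᶜ.CliqueFree L)
    (hH : H.CliqueFree 20) (hH' : Hᶜ.CliqueFree T) (hV : x < Fintype.card V)
    (hW : x < Fintype.card W) : ramseyCount x ≤ 1 + 20 * L + T * T := by
  classical
  set A : Finset ℕ := {0} ∪ (range 20 ×ˢ range L).image (fun z => ramsey z.1 z.2) ∪
    (range T ×ˢ range T).image (fun z => ramsey z.1 z.2) with hA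
  have hsub : RamseySet x ⊆ A := by
    rintro m ⟨⟨k, n, hk, hkn, rfl⟩, hx⟩
    by_cases h0 : ramsey k n = 0
    · simp [hA, h0]
    simp only [hA, coe_union, Set.mem_union, mem_coe, mem_image, mem_product, mem_range]
    by_cases hk20 : k < 20
    · refine Or.inl (Or.inr ⟨(k, n), ⟨hk20, ?_⟩, rfl⟩)
      by_contra! hn
      have h := card_lt_ramsey (hG.mono hk) (hG'.mono hn) h0
      exact (hV.trans (Nat.cast_lt.2 h)).not_ge hx
    · have hn : n < T := by
        by_contra! hn
        have h := card_lt_ramsey (hH.mono (not_lt.1 hk20)) (hH'.mono hn) h0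
        exact (hW.trans (Nat.cast_lt.2 h)).not_ge hx
      exact Or.inr ⟨(k, n), ⟨hkn.trans_lt hn, hn⟩, rfl⟩
  calc ramseyCount x ≤ (A : Set ℕ).ncard := Set.ncard_le_ncard hsub (Finset.finite_toSet A)
    _ = #A := Set.ncard_coe_finset A
    _ ≤ _ := by
      refine (card_union_le _ _).trans (Nat.add_le_add ((card_union_le _ _).trans
        (Nat.add_le_add (by simp) (card_image_le.trans ?_))) (card_image_le.trans ?_))
      · simp
      · simp

open Filter in
theorem eventually_ceil_sqrt_log : ∀ᶠ r : ℕ in atTop, 1 ≤ ⌈√(Real.log r)⌉₊ ∧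
    10000000000 * ⌈√(Real.log r)⌉₊ ^ 8 ≤ r ∧ Real.log r ≤ (⌈√(Real.log r)⌉₊ : ℝ) ^ 2 := by
  have h1 : ∀ᶠ r : ℕ in atTop, ‖Real.log r ^ 4‖ ≤ (1 / 2560000000000) * ‖(r : ℝ)‖ :=
    tendsto_natCast_atTop_atTop.eventually ((isLittleO_pow_log_id_atTop (n := 4)).def (by norm_num))
  have h2 : ∀ᶠ r : ℕ in atTop, 1 ≤ Real.log r :=
    (Real.tendsto_log_atTop.comp tendsto_natCast_atTop_atTop).eventually_ge_atTop 1
  filter_upwards [h1, h2] with r h1 h2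
  have hs1 : 1 ≤ √(Real.log r) := Real.one_le_sqrt.2 h2
  have hle := Nat.le_ceil √(Real.log r)
  have hlt := Nat.ceil_lt_add_one (Real.sqrt_nonneg (Real.log r))
  have hsq : √(Real.log r) ^ 2 = Real.log r := Real.sq_sqrt (by linarith)
  refine ⟨Nat.one_le_ceil_iff.2 (by linarith), ?_, ?_⟩
  · rw [Real.norm_of_nonneg (by positivity), Real.norm_of_nonneg (by positivity)] at h1
    have : (10000000000 : ℝ) * (⌈√(Real.log r)⌉₊ : ℝ) ^ 8 ≤ r := by
      calc (10000000000 : ℝ) * (⌈√(Real.log r)⌉₊ : ℝ) ^ 8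
          ≤ 10000000000 * (2 * √(Real.log r)) ^ 8 := by gcongr; linarith
        _ = 2560000000000 * (√(Real.log r) ^ 2) ^ 4 := by ring
        _ ≤ r := by rw [hsq]; linarith
    exact_mod_cast this
  · calc Real.log r = √(Real.log r) ^ 2 := hsq.symm
      _ ≤ _ := by gcongr

theorem lt_floor_rpow_add_one_pow {x : ℝ} (hx : 0 ≤ x) {j : ℕ} (hj : j ≠ 0) :
    x < ((⌊x ^ (1 / j : ℝ)⌋₊ + 1 : ℕ) : ℝ) ^ j := by
  have hj' : (j : ℝ) ≠ 0 := by exact_mod_cast hj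
  calc x = (x ^ (1 / j : ℝ)) ^ j := by
        rw [← Real.rpow_mul_natCast hx, one_div, inv_mul_cancel₀ hj', Real.rpow_one]
    _ < _ := by
        refine pow_lt_pow_left₀ ?_ (by positivity) hj
        push_cast
        exact Nat.lt_floor_add_one _

theorem floor_rpow_add_one_pow_le {x : ℝ} (hx : 1 ≤ x) {i j : ℕ} (hj : j ≠ 0) (hij : 2 * i ≤ j) :
    ((⌊x ^ (1 / j : ℝ)⌋₊ + 1 : ℕ) : ℝ) ^ i ≤ 2 ^ i * √x := by
  have hj' : (0 : ℝ) < j := by exact_mod_cast Nat.pos_of_ne_zero hj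
  have h1 : (1 : ℝ) ≤ x ^ (1 / j : ℝ) := Real.one_le_rpow hx (by positivity)
  have h2 : ((⌊x ^ (1 / j : ℝ)⌋₊ + 1 : ℕ) : ℝ) ≤ 2 * x ^ (1 / j : ℝ) := by
    push_cast
    linarith [Nat.floor_le (zero_le_one.trans h1)]
  calc _ ≤ (2 * x ^ (1 / j : ℝ)) ^ i := by gcongr
    _ = 2 ^ i * x ^ ((1 / j : ℝ) * i) := by rw [mul_pow, Real.rpow_mul_natCast (by linarith)]
    _ ≤ 2 ^ i * √x := by
      rw [Real.sqrt_eq_rpow]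
      gcongr ?_ * ?_
      refine Real.rpow_le_rpow_of_exponent_le hx ?_
      have : (2 * i : ℝ) ≤ j := by exact_mod_cast hij
      rw [one_div_mul_eq_div, div_le_div_iff₀ hj' (by norm_num)]
      linarith

open Filter in
theorem tendsto_floor_rpow_add_one {j : ℕ} (hj : j ≠ 0) :
    Tendsto (fun x : ℝ => ⌊x ^ (1 / j : ℝ)⌋₊ + 1) atTop atTop := by
  have hj' : (0 : ℝ) < j := by exact_mod_cast Nat.pos_of_ne_zero hj
  exact (tendsto_add_atTop_nat 1).comp
    (tendsto_nat_floor_atTop.comp (tendsto_rpow_atTop (by positivity)))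

open Filter in
theorem eventually_ramseyCount_le : ∀ᶠ x : ℝ in atTop,
    (ramseyCount x : ℝ) ≤ 20000000000 * Real.sqrt (x * Real.log x) := by
  have hM : ∀ᶠ M : ℕ in atTop, ‖Real.log M‖ ≤ (1 / 40) * ‖(M : ℝ)‖ :=
    tendsto_natCast_atTop_atTop.eventually (Real.isLittleO_log_id_atTop.def (by norm_num))
  filter_upwards [eventually_ge_atTop 4, (tendsto_floor_rpow_add_one (j := 16)
    (by norm_num)).eventually eventually_ceil_sqrt_log, (tendsto_floor_rpow_add_one (j := 9)
    (by norm_num)).eventually (hM.and (eventually_ge_atTop 100))] with x hx4 hr hM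
  have hx1 : (1 : ℝ) ≤ x := by linarith
  have hlogx : 1 ≤ Real.log x := by
    rw [Real.le_log_iff_exp_le (by linarith)]
    linarith [exp_one_le_three]
  have hr16 := lt_floor_rpow_add_one_pow (x := x) (by linarith) (j := 16) (by norm_num)
  have hr8 := floor_rpow_add_one_pow_le hx1 (i := 8) (j := 16) (by norm_num) (by norm_num)
  have hr1 := floor_rpow_add_one_pow_le hx1 (i := 1) (j := 16) (by norm_num) (by norm_num)
  have hM9 := lt_floor_rpow_add_one_pow (x := x) (by linarith) (j := 9) (by norm_num)
  have hM4 := floor_rpow_add_one_pow_le hx1 (i := 4) (j := 9) (by norm_num) (by norm_num)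
  set r := ⌊x ^ (1 / (16 : ℕ) : ℝ)⌋₊ + 1 with hrdef
  set M := ⌊x ^ (1 / (9 : ℕ) : ℝ)⌋₊ + 1 with hMdef
  set ℓ := ⌈√(Real.log r)⌉₊ with hℓ
  obtain ⟨hM40, hM100⟩ := hM
  obtain ⟨G, hG, hG'⟩ := exists_cliqueFree_three hr.1 hr.2.1 hr.2.2
  obtain ⟨H, hH, hH'⟩ := exists_cliqueFree_twenty hM100 (by
    rw [Real.norm_natCast] at hM40
    linarith [(le_abs_self _).trans hM40])
  have hcount := ramseyCount_le (x := x) hG hG' hH hH'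
    (by rw [Fintype.card_prod, Fintype.card_fin, Fintype.card_fin, ← pow_add]; exact_mod_cast hr16)
    (by rw [Fintype.card_fin]; exact_mod_cast hM9)
  have hcount' : (ramseyCount x : ℝ) ≤
      1 + 20 * (16 * (100000 * ℓ * (r : ℝ) ^ 8)) + (M : ℝ) ^ 4 := by
    refine (Nat.cast_le.2 hcount).trans (le_of_eq ?_)
    push_cast
    ring
  have hs2 : 2 ≤ √x := Real.le_sqrt_of_sq_le (by linarith)
  have hsx : √x * √x = x := Real.mul_self_sqrt (by linarith)
  have hl1 : 1 ≤ √(Real.log x) := Real.one_le_sqrt.2 hlogx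
  have hℓx : (ℓ : ℝ) ≤ 2 * √(Real.log x) := by
    have h1 := Nat.ceil_lt_add_one (Real.sqrt_nonneg (Real.log r))
    have h2 : √(Real.log r) ≤ √(Real.log x) := by
      refine Real.sqrt_le_sqrt (Real.log_le_log (by positivity) ?_)
      rw [pow_one, pow_one] at hr1
      nlinarith
    linarith
  rw [Real.sqrt_mul (by linarith)]
  have h1 : (ℓ : ℝ) * (r : ℝ) ^ 8 ≤ 2 * √(Real.log x) * (2 ^ 8 * √x) := by gcongr
  have h2 : √x ≤ √x * √(Real.log x) := le_mul_of_one_le_right (by linarith) hl1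
  linarith

/-- upper bound `r(x) ≤ b √(x ln x)`. -/
theorem ramseyCount_upper_bound :
    ∃ b x₀ : ℝ, 0 < b ∧ 0 < x₀ ∧ ∀ x : ℝ, x₀ ≤ x →
      (ramseyCount x : ℝ) ≤ b * Real.sqrt (x * Real.log x) := by
  obtain ⟨x₀, hx₀⟩ := Filter.eventually_atTop.1 eventually_ramseyCount_le
  exact ⟨20000000000, max x₀ 1, by norm_num, by positivity,
    fun x hx => hx₀ x ((le_max_left _ _).trans hx)⟩
end

section
/- Suppose there exist real constants 0 < c₁ < c₂ such that c₁·n²/ln n ≤ r(3,n) ≤ c₂·n²/ln n for all integers n ≥ 3. Then there exists a real x₁ ≥ 6 such that for all real x ≥ x₁, r₃(x) ≥ (4c₂)^{-1/2}·√(x·ln x). -/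
open SimpleGraph Finset Real

/-- By adding a vertex all of whose edges are blue, an arrowing property of `K + 1` for
`n + 1` descends to an arrowing property of `K` for `n`. -/
lemma exists_isNClique_or_compl_of_succ {k n K : ℕ} (hk : 1 < k)
    (h : ∀ G : SimpleGraph (Fin (K + 1)),
      (∃ s : Finset (Fin (K + 1)), G.IsNClique k s) ∨
        (∃ s : Finset (Fin (K + 1)), Gᶜ.IsNClique (n + 1) s))
    (G : SimpleGraph (Fin K)) :
    (∃ s : Finset (Fin K), G.IsNClique k s) ∨ (∃ s : Finset (Fin K), Gᶜ.IsNClique n s) := by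
  rcases h (G.map Fin.castSuccEmb) with ⟨s, hs⟩ | ⟨s, hs⟩
  · obtain ⟨t, ht, -⟩ := (SimpleGraph.isNClique_map_iff hk).1 hs
    exact Or.inl ⟨t, ht⟩
  · right
    set t : Finset (Fin K) := s.preimage Fin.castSucc (Fin.castSucc_injective K).injOn with ht
    have hsub : s ⊆ insert (Fin.last K) (t.map Fin.castSuccEmb) := by
      intro x hx
      induction x using Fin.lastCases with
      | last => simp
      | cast y => simp [ht, hx]
    have hcard : n ≤ #t := by
      have h₁ := Finset.card_le_card hsub
      have h₂ := Finset.card_insert_le (Fin.last K) (t.map Fin.castSuccEmb)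
      rw [hs.card_eq] at h₁
      rw [Finset.card_map] at h₂
      omega
    obtain ⟨u, hut, hu⟩ := Finset.exists_subset_card_eq hcard
    refine ⟨u, ?_, hu⟩
    intro a ha b hb hab
    have ha' : a.castSucc ∈ s := by simpa [ht] using hut ha
    have hb' : b.castSucc ∈ s := by simpa [ht] using hut hb
    have hadj := hs.isClique ha' hb' (fun e => hab (Fin.castSucc_injective K e))
    rw [SimpleGraph.compl_adj] at hadj ⊢
    exact ⟨hab, fun hG => hadj.2 ((SimpleGraph.map_adj_apply (f := Fin.castSuccEmb)).2 hG)⟩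

/-- Where it is not a junk value, `ramsey k` is strictly increasing. -/
lemma ramsey_lt_ramsey_succ {k n : ℕ} (hk : 1 < k) (hn : 1 ≤ n)
    (hpos : 0 < ramsey k (n + 1)) : ramsey k n < ramsey k (n + 1) := by
  have hmem : ramsey k (n + 1) ∈ {N : ℕ | 0 < N ∧ ∀ G : SimpleGraph (Fin N),
      (∃ s : Finset (Fin N), G.IsNClique k s) ∨ (∃ s : Finset (Fin N), Gᶜ.IsNClique (n + 1) s)} :=
    Nat.sInf_mem (Nat.nonempty_of_pos_sInf hpos)
  obtain ⟨K, hK⟩ : ∃ K, ramsey k (n + 1) = K + 1 := ⟨_, (Nat.succ_pred_eq_of_pos hpos).symm⟩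
  rw [hK] at hmem ⊢
  have hdesc := exists_isNClique_or_compl_of_succ hk hmem.2
  refine Nat.lt_succ_of_le (Nat.sInf_le ⟨Nat.pos_of_ne_zero ?_, hdesc⟩)
  rintro rfl
  rcases hdesc ⊥ with ⟨s, hs⟩ | ⟨s, hs⟩
  · have := hs.card_eq
    simp [Finset.eq_empty_of_isEmpty s] at this
    omega
  · have := hs.card_eq
    simp [Finset.eq_empty_of_isEmpty s] at this
    omega

lemma finite_ramseySetRow (k : ℕ) (x : ℝ) : (RamseySetRow k x).Finite :=
  (Set.finite_Iic ⌊x⌋₊).subset fun _ hm => Nat.le_floor hm.2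

/-- If `ramsey k` is strictly increasing from `k` on, then the row below `x` has at least
`j + 1` elements as soon as `ramsey k (k + j) ≤ x`. -/
lemma le_ramseyCountRow {k j : ℕ} {x : ℝ}
    (hmono : StrictMono fun i => ramsey k (k + i)) (hx : (ramsey k (k + j) : ℝ) ≤ x) :
    j + 1 ≤ ramseyCountRow k x := by
  have hsub : (((Finset.range (j + 1)).image fun i => ramsey k (k + i) : Finset ℕ) : Set ℕ) ⊆
      RamseySetRow k x := by
    intro m hm
    simp only [Finset.coe_image, Set.mem_image, Finset.mem_coe, Finset.mem_range] at hm
    obtain ⟨i, hi, rfl⟩ := hm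
    refine ⟨⟨k + i, by omega, rfl⟩, le_trans ?_ hx⟩
    exact_mod_cast hmono.monotone (Nat.le_of_lt_succ hi)
  have h := Set.ncard_le_ncard hsub (finite_ramseySetRow k x)
  rwa [Set.ncard_coe_finset, Finset.card_image_of_injective _ hmono.injective,
    Finset.card_range] at h

/-- With `y = √(x log x / (4c))`, any `m ∈ [y, y + 3]` satisfies `c m² / log m ≤ x` for
large `x`. -/
lemma mul_sq_div_log_le {c x y m : ℝ} (hc : 0 < c) (hx : 64 ≤ x) (hlog : 4 * c ≤ Real.log x)
    (hy : 0 ≤ y) (hy2 : 4 * c * y ^ 2 = x * Real.log x) (hym : y ≤ m) (hmy : m ≤ y + 3) :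
    c * m ^ 2 / Real.log m ≤ x := by
  have hxy : x ≤ y ^ 2 := by
    have : 4 * c * x ≤ 4 * c * y ^ 2 := by rw [hy2]; nlinarith
    exact le_of_mul_le_mul_left this (by positivity)
  have hy8 : 8 ≤ y := by nlinarith
  have hlogm : Real.log x ≤ 2 * Real.log m := by
    have h := Real.log_le_log (by linarith) (hxy.trans (pow_le_pow_left₀ hy hym 2))
    rwa [Real.log_pow, Nat.cast_ofNat] at h
  have hm2 : m ^ 2 ≤ 2 * y ^ 2 := by nlinarith
  rw [div_le_iff₀ (by linarith)]
  nlinarith [mul_le_mul_of_nonneg_left hm2 hc.le,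
    mul_le_mul_of_nonneg_left hlogm (by linarith : (0 : ℝ) ≤ x)]

/-- Kim's bounds for `r(3,n)` give the lower bound
`r₃(x) ≥ (4c₂)^{-1/2} √(x ln x)` for large `x`. -/
theorem ramseyCountRow_three_lower (c₁ c₂ : ℝ) (hc₁ : 0 < c₁) (hc₁c₂ : c₁ < c₂)
    (hr : ∀ n : ℕ, 3 ≤ n →
      c₁ * (n : ℝ) ^ 2 / Real.log n ≤ (ramsey 3 n : ℝ) ∧
      (ramsey 3 n : ℝ) ≤ c₂ * (n : ℝ) ^ 2 / Real.log n) :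
    ∃ x₁ : ℝ, 6 ≤ x₁ ∧ ∀ x : ℝ, x₁ ≤ x →
      (4 * c₂) ^ (-(1 : ℝ) / 2) * Real.sqrt (x * Real.log x) ≤ (ramseyCountRow 3 x : ℝ) := by
  have hc₂ : 0 < c₂ := hc₁.trans hc₁c₂
  have hpos (n : ℕ) (hn : 3 ≤ n) : 0 < ramsey 3 n := by
    have hn' : (3 : ℝ) ≤ n := by exact_mod_cast hn
    have hlog : 0 < Real.log n := Real.log_pos (by linarith)
    have h : (0 : ℝ) < c₁ * (n : ℝ) ^ 2 / Real.log n := by positivity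
    exact_mod_cast h.trans_le (hr n hn).1
  have hmono : StrictMono fun i => ramsey 3 (3 + i) :=
    strictMono_nat_of_lt_succ fun i =>
      ramsey_lt_ramsey_succ (by norm_num) (by omega) (hpos (3 + i + 1) (by omega))
  refine ⟨max 64 (Real.exp (4 * c₂)), by linarith [le_max_left 64 (Real.exp (4 * c₂))], ?_⟩
  intro x hx
  have hx64 : 64 ≤ x := (le_max_left _ _).trans hx
  have hlog : 4 * c₂ ≤ Real.log x :=
    (Real.le_log_iff_exp_le (by linarith)).2 ((le_max_right _ _).trans hx)
  set y : ℝ := (4 * c₂) ^ (-(1 : ℝ) / 2) * Real.sqrt (x * Real.log x) with hy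
  have hy0 : 0 ≤ y := by positivity
  have hy2 : 4 * c₂ * y ^ 2 = x * Real.log x := by
    have hpow : ((4 * c₂) ^ (-(1 : ℝ) / 2)) ^ 2 = (4 * c₂)⁻¹ := by
      rw [← Real.rpow_natCast, ← Real.rpow_mul (by positivity), ← Real.rpow_neg_one]
      norm_num
    have hnn : 0 ≤ x * Real.log x := mul_nonneg (by linarith) (by linarith)
    rw [hy, mul_pow, hpow, Real.sq_sqrt hnn]
    field_simp
  have hfloor := Nat.floor_le hy0
  have hlt := Nat.lt_floor_add_one y
  have hm : ((3 + ⌊y⌋₊ : ℕ) : ℝ) = 3 + (⌊y⌋₊ : ℝ) := by push_cast; ring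
  have hramsey : (ramsey 3 (3 + ⌊y⌋₊) : ℝ) ≤ x :=
    (hr _ (by omega)).2.trans
      (mul_sq_div_log_le hc₂ hx64 hlog hy0 hy2 (by rw [hm]; linarith) (by rw [hm]; linarith))
  have hcount : ((⌊y⌋₊ + 1 : ℕ) : ℝ) ≤ ramseyCountRow 3 x := by
    exact_mod_cast le_ramseyCountRow hmono hramsey
  push_cast at hcount
  linarith
end

section
/- Suppose there exist real constants 0 < c₁ < c₂ such that c₁·n²/ln n ≤ r(3,n) ≤ c₂·n²/ln n for all integers n ≥ 3. Then there exists a real x₁ ≥ 6 such that for all real x ≥ x₁, r₃(x) ≤ c₁^{-1/2}·√(x·ln x). -/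
open SimpleGraph Finset Real

/-- If `c t² / log t ≤ x` then `t ≤ y`, where `c y² = x log x` and `3 ≤ y ≤ x`. -/
lemma le_of_mul_sq_div_log_le {c x y t : ℝ} (hc : 0 < c) (hy : 3 ≤ y) (hyx : y ≤ x)
    (hcy : c * y ^ 2 = x * Real.log x) (ht : 3 ≤ t) (h : c * t ^ 2 / Real.log t ≤ x) :
    t ≤ y := by
  by_contra! hlt
  have he : Real.exp 1 ≤ 3 := Real.exp_one_lt_three.le
  have hanti : Real.log t / t ≤ Real.log y / y :=
    Real.log_div_self_antitoneOn (he.trans hy) (he.trans ht) hlt.le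
  have hlog : Real.log y ≤ Real.log x := Real.log_le_log (by linarith) hyx
  have hx : 0 ≤ x := by linarith
  have ht0 : 0 < t := by linarith
  have hy0 : 0 < y := by linarith
  rw [div_le_iff₀ (Real.log_pos (by linarith))] at h
  rw [div_le_div_iff₀ ht0 hy0] at hanti
  have hle : t * (c * t * y) ≤ t * (c * y ^ 2) := calc
    t * (c * t * y) = (c * t ^ 2) * y := by ring
    _ ≤ x * Real.log t * y := by gcongr
    _ = x * (Real.log t * y) := by ring
    _ ≤ x * (Real.log y * t) := by gcongr
    _ ≤ x * (Real.log x * t) := by gcongr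
    _ = t * (c * y ^ 2) := by rw [hcy]; ring
  have hle' : c * t * y ≤ c * y ^ 2 := le_of_mul_le_mul_left hle ht0
  have hpos : 0 < c * y * (t - y) := mul_pos (mul_pos hc hy0) (by linarith)
  nlinarith

/-- If `r(k,n) ≤ x` forces `n ≤ y` and `k` is positive, then `r_k(x) ≤ y`. -/
lemma ramseyCountRow_le_of_forall_le {k : ℕ} {x y : ℝ} (hk : 0 < k) (hy : 0 ≤ y)
    (h : ∀ n : ℕ, k ≤ n → (ramsey k n : ℝ) ≤ x → (n : ℝ) ≤ y) :
    (ramseyCountRow k x : ℝ) ≤ y := by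
  have hsub : RamseySetRow k x ⊆ ((Finset.Icc 1 ⌊y⌋₊).image (ramsey k) : Finset ℕ) := by
    rintro m ⟨⟨n, hn, rfl⟩, hm⟩
    rw [Finset.mem_coe, Finset.mem_image]
    exact ⟨n, Finset.mem_Icc.2 ⟨hk.trans_le hn, Nat.le_floor (h n hn hm)⟩, rfl⟩
  have hcard : ramseyCountRow k x ≤ ⌊y⌋₊ := calc
    ramseyCountRow k x ≤ ((Finset.Icc 1 ⌊y⌋₊).image (ramsey k)).card := by
      rw [← Set.ncard_coe_finset]
      exact Set.ncard_le_ncard hsub (Finset.finite_toSet _)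
    _ ≤ (Finset.Icc 1 ⌊y⌋₊).card := Finset.card_image_le
    _ = ⌊y⌋₊ := by simp
  exact (Nat.cast_le.2 hcard).trans (Nat.floor_le hy)

/-- Kim's bounds for `r(3,n)` give the upper bound
`r₃(x) ≤ c₁^{-1/2} √(x ln x)` for large `x`. -/
theorem ramseyCountRow_three_upper (c₁ c₂ : ℝ) (hc₁ : 0 < c₁) (hc₁c₂ : c₁ < c₂)
    (hr : ∀ n : ℕ, 3 ≤ n →
      c₁ * (n : ℝ) ^ 2 / Real.log n ≤ (ramsey 3 n : ℝ) ∧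
      (ramsey 3 n : ℝ) ≤ c₂ * (n : ℝ) ^ 2 / Real.log n) :
    ∃ x₁ : ℝ, 6 ≤ x₁ ∧ ∀ x : ℝ, x₁ ≤ x →
      (ramseyCountRow 3 x : ℝ) ≤ c₁ ^ (-(1 : ℝ) / 2) * Real.sqrt (x * Real.log x) := by
  have hlog : ∀ᶠ x : ℝ in Filter.atTop, ‖Real.log x‖ ≤ c₁ * ‖x‖ :=
    Real.isLittleO_log_id_atTop.bound hc₁
  obtain ⟨a, ha⟩ := Filter.eventually_atTop.1 hlog
  refine ⟨max a (max 6 (9 * c₁)), le_max_of_le_right (le_max_left _ _), fun x hx => ?_⟩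
  simp only [max_le_iff] at hx
  obtain ⟨hax, hx6, hx9⟩ := hx
  have hlog1 : 1 ≤ Real.log x := by
    rw [Real.le_log_iff_exp_le (by linarith)]
    linarith [Real.exp_one_lt_three]
  have hlogx : Real.log x ≤ c₁ * x := by
    have := ha x hax
    rwa [Real.norm_of_nonneg (by linarith), Real.norm_of_nonneg (by linarith)] at this
  have hxlog : 0 ≤ x * Real.log x := mul_nonneg (by linarith) (by linarith)
  set y := c₁ ^ (-(1 : ℝ) / 2) * Real.sqrt (x * Real.log x) with hy
  have hy0 : 0 ≤ y := by positivity
  have hcy : c₁ * y ^ 2 = x * Real.log x := by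
    have hsq : (c₁ ^ (-(1 : ℝ) / 2)) ^ 2 = c₁⁻¹ := by
      rw [← Real.rpow_natCast, ← Real.rpow_mul hc₁.le, ← Real.rpow_neg_one]
      norm_num
    rw [hy, mul_pow, Real.sq_sqrt hxlog, hsq, mul_inv_cancel_left₀ hc₁.ne']
  have hy3 : 3 ≤ y := by
    refine le_of_sq_le_sq (le_of_mul_le_mul_left ?_ hc₁) hy0
    nlinarith
  have hyx : y ≤ x := by
    refine le_of_sq_le_sq (le_of_mul_le_mul_left ?_ hc₁) (by linarith)
    nlinarith
  refine ramseyCountRow_le_of_forall_le (by norm_num) hy0 fun n hn hm => ?_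
  exact le_of_mul_sq_div_log_le hc₁ hy3 hyx hcy (by exact_mod_cast hn) ((hr n hn).1.trans hm)
end

section
/- Let d be a real number with 0 < d ≤ 1 such that r(k,n) ≥ d·n^{9/4} for all integers n ≥ k ≥ 4. Then for every real x ≥ 8 satisfying x ≥ 2^{9/4}·d^{81/16}·(log₂ x)^{9/4}, one has Σ_{k=4}^{⌊2·log₂ x⌋} r_k(x) ≤ 2·d^{-9/4}·(log₂ x)·x^{4/9}. -/
open SimpleGraph Finset Real

/-- A power lower bound on `ramsey k n` bounds the number of values of row `k` up to `x`. -/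
theorem ramseyCountRow_le_rpow {a d x : ℝ} {k : ℕ} (ha : 0 < a) (hd : 0 < d) (hx : 0 ≤ x)
    (hk : 1 ≤ k) (hr : ∀ n : ℕ, k ≤ n → d * (n : ℝ) ^ a ≤ (ramsey k n : ℝ)) :
    (ramseyCountRow k x : ℝ) ≤ (x / d) ^ a⁻¹ := by
  have hB : 0 ≤ (x / d) ^ a⁻¹ := by positivity
  have hsub : RamseySetRow k x ⊆
      ((Finset.Icc 1 ⌊(x / d) ^ a⁻¹⌋₊).image (ramsey k) : Finset ℕ) := by
    rintro _ ⟨⟨n, hn, rfl⟩, hnx⟩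
    simp only [Finset.coe_image, Finset.coe_Icc]
    refine ⟨n, ⟨hk.trans hn, Nat.le_floor ?_⟩, rfl⟩
    rw [Real.le_rpow_inv_iff_of_pos n.cast_nonneg (by positivity) ha, le_div_iff₀' hd]
    exact (hr n hn).trans hnx
  have hcard : ramseyCountRow k x ≤ ⌊(x / d) ^ a⁻¹⌋₊ := by
    calc ramseyCountRow k x
        ≤ ((Finset.Icc 1 ⌊(x / d) ^ a⁻¹⌋₊).image (ramsey k)).card := by
          rw [← Set.ncard_coe_finset]
          exact Set.ncard_le_ncard hsub (Finset.finite_toSet _)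
      _ ≤ (Finset.Icc 1 ⌊(x / d) ^ a⁻¹⌋₊).card := Finset.card_image_le
      _ = ⌊(x / d) ^ a⁻¹⌋₊ := by simp
  exact (Nat.cast_le.mpr hcard).trans (Nat.floor_le hB)

/-- if `r(k,n) ≥ d n^{9/4}` for `n ≥ k ≥ 4`, then for `x ≥ 8` with
`x ≥ 2^{9/4} d^{81/16} (log₂ x)^{9/4}`, the sum `Σ_{k=4}^{⌊2 log₂ x⌋} r_k(x)`
is at most `2 d^{-9/4} (log₂ x) x^{4/9}`. -/
theorem sum_ramseyCountRow_le (d : ℝ) (hd0 : 0 < d) (hd1 : d ≤ 1)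
    (hr : ∀ k n : ℕ, 4 ≤ k → k ≤ n → d * (n : ℝ) ^ ((9 : ℝ) / 4) ≤ (ramsey k n : ℝ))
    (x : ℝ) (hx : 8 ≤ x)
    (hx' : 2 ^ ((9 : ℝ) / 4) * d ^ ((81 : ℝ) / 16) * (Real.logb 2 x) ^ ((9 : ℝ) / 4) ≤ x) :
    ((∑ k ∈ Finset.Icc 4 ⌊2 * Real.logb 2 x⌋₊, ramseyCountRow k x : ℕ) : ℝ) ≤
      2 * d ^ (-(9 : ℝ) / 4) * Real.logb 2 x * x ^ ((4 : ℝ) / 9) := by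
  have hx0 : 0 < x := by linarith
  have hlog : 0 ≤ Real.logb 2 x := Real.logb_nonneg (by norm_num) (by linarith)
  have hrow : ∀ k ∈ Finset.Icc 4 ⌊2 * Real.logb 2 x⌋₊,
      (ramseyCountRow k x : ℝ) ≤ d ^ (-(9 : ℝ) / 4) * x ^ ((4 : ℝ) / 9) := by
    intro k hk
    have hk4 : 4 ≤ k := (Finset.mem_Icc.mp hk).1
    calc (ramseyCountRow k x : ℝ) ≤ (x / d) ^ ((9 : ℝ) / 4)⁻¹ :=
          ramseyCountRow_le_rpow (by norm_num) hd0 hx0.le (by omega) fun n hn => hr k n hk4 hn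
      _ = d ^ (-(4 : ℝ) / 9) * x ^ ((4 : ℝ) / 9) := by
          rw [inv_div, Real.div_rpow hx0.le hd0.le, neg_div, Real.rpow_neg hd0.le, div_eq_inv_mul]
      _ ≤ d ^ (-(9 : ℝ) / 4) * x ^ ((4 : ℝ) / 9) := by
          gcongr ?_ * _
          exact Real.rpow_le_rpow_of_exponent_ge hd0 hd1 (by norm_num)
  have hcard : ((Finset.Icc 4 ⌊2 * Real.logb 2 x⌋₊).card : ℝ) ≤ 2 * Real.logb 2 x := by
    refine le_trans ?_ (Nat.floor_le (by positivity : 0 ≤ 2 * Real.logb 2 x))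
    rw [Nat.card_Icc]
    exact_mod_cast (by omega)
  push_cast
  calc ∑ k ∈ Finset.Icc 4 ⌊2 * Real.logb 2 x⌋₊, (ramseyCountRow k x : ℝ)
      ≤ (Finset.Icc 4 ⌊2 * Real.logb 2 x⌋₊).card * (d ^ (-(9 : ℝ) / 4) * x ^ ((4 : ℝ) / 9)) := by
        rw [← nsmul_eq_mul]
        exact Finset.sum_le_card_nsmul _ _ _ hrow
    _ ≤ 2 * Real.logb 2 x * (d ^ (-(9 : ℝ) / 4) * x ^ ((4 : ℝ) / 9)) := by gcongr
    _ = 2 * d ^ (-(9 : ℝ) / 4) * Real.logb 2 x * x ^ ((4 : ℝ) / 9) := by ring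
end

section
/- Let d be a real number with 0 < d ≤ 1 such that r(k,n) ≥ d·n^{9/4} for all integers n ≥ k ≥ 4, and let c₃, c₄ > 0 and x₁ ≥ 6 be real numbers such that c₃·√(x·ln x) ≤ r₃(x) ≤ c₄·√(x·ln x) for all real x ≥ x₁. Then there exists a real x₂ ≥ 8 such that for all real x ≥ max{x₁, x₂}, one has c₃·√(x·ln x) ≤ r(x) ≤ c₄·√(x·ln x) + 2·d^{-9/4}·(log₂ x)·x^{4/9}. -/
open SimpleGraph Finset Real

/-- Erdős' counting bound: if every graph on `N` vertices has a clique or an independent set on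
`k` vertices, then `2 ^ (k choose 2) ≤ 2 * (N choose k)`. -/
theorem two_pow_choose_two_le_of_forall_graph (N k : ℕ)
    (h : ∀ G : SimpleGraph (Fin N),
      (∃ s : Finset (Fin N), G.IsNClique k s) ∨ (∃ s : Finset (Fin N), Gᶜ.IsNClique k s)) :
    2 ^ k.choose 2 ≤ 2 * N.choose k := by
  classical
  let A : Finset (Fin N) → Finset (Sym2 (Fin N)) := fun s =>
    s.offDiag.image (Function.uncurry Sym2.mk)
  have card_A : ∀ s, (A s).card = s.card.choose 2 := fun s => Sym2.card_image_offDiag s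
  let U := Fintype.card (Sym2 (Fin N))
  have hcover : (Finset.univ : Finset (Finset (Sym2 (Fin N)))) ⊆
      (Finset.powersetCard k Finset.univ).biUnion
        (fun s => Finset.Icc (A s) Finset.univ ∪ (A s)ᶜ.powerset) := by
    intro E _
    rw [Finset.mem_biUnion]
    rcases h (SimpleGraph.fromEdgeSet (E : Set (Sym2 (Fin N)))) with ⟨s, hs⟩ | ⟨s, hs⟩
    · refine ⟨s, by simp [hs.card_eq], Finset.mem_union_left _ ?_⟩
      rw [Finset.mem_Icc]
      refine ⟨fun e he => ?_, Finset.subset_univ _⟩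
      obtain ⟨⟨a, b⟩, hab, rfl⟩ := Finset.mem_image.1 he
      rw [Finset.mem_offDiag] at hab
      have := hs.isClique hab.1 hab.2.1 hab.2.2
      simpa using (SimpleGraph.fromEdgeSet_adj _ |>.1 this).1
    · refine ⟨s, by simp [hs.card_eq], Finset.mem_union_right _ ?_⟩
      rw [Finset.mem_powerset]
      intro e heE
      rw [Finset.mem_compl]
      intro he
      obtain ⟨⟨a, b⟩, hab, rfl⟩ := Finset.mem_image.1 he
      rw [Finset.mem_offDiag] at hab
      have := hs.isClique hab.1 hab.2.1 hab.2.2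
      rw [SimpleGraph.compl_adj] at this
      exact this.2 (SimpleGraph.fromEdgeSet_adj _ |>.2 ⟨by simpa using heE, hab.2.2⟩)
  have hcount : 2 ^ U ≤ N.choose k * (2 * 2 ^ (U - k.choose 2)) := by
    calc 2 ^ U = (Finset.univ : Finset (Finset (Sym2 (Fin N)))).card := by
          rw [Finset.card_univ, Fintype.card_finset]
      _ ≤ _ := Finset.card_le_card hcover
      _ ≤ (Finset.powersetCard k (Finset.univ : Finset (Fin N))).card *
            (2 * 2 ^ (U - k.choose 2)) := by
          refine Finset.card_biUnion_le_card_mul _ _ _ fun s hs => ?_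
          have hsc := (Finset.mem_powersetCard.1 hs).2
          refine (Finset.card_union_le _ _).trans ?_
          rw [Finset.card_Icc_finset (Finset.subset_univ _), Finset.card_powerset,
            Finset.card_compl, Finset.card_univ, card_A, hsc, two_mul]
      _ = _ := by rw [Finset.card_powersetCard, Finset.card_univ, Fintype.card_fin]
  by_cases hN : k ≤ N
  · have hle : k.choose 2 ≤ U := by
      obtain ⟨s, -, hs⟩ := Finset.exists_subset_card_eq
        (show k ≤ (Finset.univ : Finset (Fin N)).card by simpa using hN)
      rw [← hs, ← card_A]
      exact Finset.card_le_univ _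
    have hsplit : 2 ^ U = 2 ^ k.choose 2 * 2 ^ (U - k.choose 2) := by
      rw [← pow_add, Nat.add_sub_cancel' hle]
    rw [hsplit] at hcount
    refine Nat.le_of_mul_le_mul_right (hcount.trans_eq (by ring)) (by positivity)
  · rw [Nat.choose_eq_zero_of_lt (not_le.1 hN), zero_mul] at hcount
    exact absurd hcount (show 0 < 2 ^ U by positivity).not_ge

theorem four_mul_two_pow_le_factorial_sq {k : ℕ} (hk : 4 ≤ k) : 4 * 2 ^ k ≤ k.factorial ^ 2 := by
  induction k, hk using Nat.le_induction with
  | base => decide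
  | succ m hm ih =>
    calc 4 * 2 ^ (m + 1) = 2 * (4 * 2 ^ m) := by ring
      _ ≤ (m + 1) ^ 2 * m.factorial ^ 2 := Nat.mul_le_mul (by nlinarith) ih
      _ = (m + 1).factorial ^ 2 := by rw [Nat.factorial_succ, mul_pow]

/-- A graph order forcing cliques or independent sets on `k ≥ 4` vertices is at least
`2 ^ (k/2)`. -/
theorem two_pow_le_sq_of_forall_graph {N k : ℕ} (hk : 4 ≤ k)
    (h : ∀ G : SimpleGraph (Fin N),
      (∃ s : Finset (Fin N), G.IsNClique k s) ∨ (∃ s : Finset (Fin N), Gᶜ.IsNClique k s)) :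
    2 ^ k ≤ N ^ 2 := by
  by_contra! hlt
  have hcount := two_pow_choose_two_le_of_forall_graph N k h
  have hfac := four_mul_two_pow_le_factorial_sq hk
  have hchoose : k.factorial * N.choose k ≤ N ^ k := by
    rw [← Nat.descFactorial_eq_factorial_mul_choose]
    exact Nat.descFactorial_le_pow N k
  have htwo : k.choose 2 * 2 + k = k * k := by
    rw [Nat.choose_two_right, Nat.div_mul_cancel (Nat.even_mul_pred_self k).two_dvd]
    obtain ⟨m, rfl⟩ : ∃ m, k = m + 1 := ⟨k - 1, by omega⟩
    simp
    ring
  have hfin : (k.factorial * 2 ^ k.choose 2) ^ 2 * 2 ^ k < 4 * 2 ^ (k * k) * 2 ^ k := by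
    refine Nat.mul_lt_mul_of_pos_right ?_ (by positivity)
    calc (k.factorial * 2 ^ k.choose 2) ^ 2 ≤ (2 * N ^ k) ^ 2 := by
          refine Nat.pow_le_pow_left ?_ 2
          calc _ ≤ k.factorial * (2 * N.choose k) := Nat.mul_le_mul_left _ hcount
            _ = 2 * (k.factorial * N.choose k) := by ring
            _ ≤ _ := Nat.mul_le_mul_left _ hchoose
      _ = 4 * (N ^ 2) ^ k := by ring
      _ < 4 * (2 ^ k) ^ k :=
          Nat.mul_lt_mul_of_pos_left (Nat.pow_lt_pow_left hlt (by omega)) (by norm_num)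
      _ = 4 * 2 ^ (k * k) := by rw [← pow_mul]
  have heq : (k.factorial * 2 ^ k.choose 2) ^ 2 * 2 ^ k = k.factorial ^ 2 * 2 ^ (k * k) := by
    rw [← htwo, pow_add, pow_mul]
    ring
  rw [heq] at hfin
  nlinarith [Nat.mul_le_mul_right (2 ^ (k * k)) hfac]

/-- The lower bound `2 ^ (k/2) ≤ r(k,n)` for `4 ≤ k ≤ n`, given that `r(k,n)` is not the junk
value `0`. -/
theorem two_pow_le_ramsey_sq {k n : ℕ} (hk : 4 ≤ k) (hkn : k ≤ n) (hpos : 0 < ramsey k n) :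
    2 ^ k ≤ ramsey k n ^ 2 := by
  refine two_pow_le_sq_of_forall_graph hk fun G => ?_
  rcases (Nat.sInf_mem (Nat.nonempty_of_pos_sInf hpos)).2 G with hs | ⟨s, hs⟩
  · exact Or.inl hs
  · obtain ⟨t, hts, ht⟩ := Finset.exists_subset_card_eq (hkn.trans_eq hs.card_eq.symm)
    exact Or.inr ⟨t, hs.isClique.subset (by exact_mod_cast hts), ht⟩

theorem finite_RamseySet (x : ℝ) : (RamseySet x).Finite :=
  (Set.finite_Iic ⌊x⌋₊).subset fun _ hm => Nat.le_floor hm.2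

theorem RamseySetRow_subset_RamseySet {k : ℕ} (hk : 3 ≤ k) (x : ℝ) :
    RamseySetRow k x ⊆ RamseySet x :=
  fun _ ⟨⟨n, hkn, hm⟩, hx⟩ => ⟨⟨k, n, hk, hkn, hm⟩, hx⟩

/-- combining the hypotheses on `d` and on `r₃`, there exists `x₂ ≥ 8`
such that for all `x ≥ max{x₁, x₂}`,
`c₃ √(x ln x) ≤ r(x) ≤ c₄ √(x ln x) + 2 d^{-9/4} (log₂ x) x^{4/9}`. -/
theorem ramseyCount_bounds (d : ℝ) (hd0 : 0 < d) (hd1 : d ≤ 1)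
    (hr : ∀ k n : ℕ, 4 ≤ k → k ≤ n → d * (n : ℝ) ^ ((9 : ℝ) / 4) ≤ (ramsey k n : ℝ))
    (c₃ c₄ x₁ : ℝ) (hc₃ : 0 < c₃) (hc₄ : 0 < c₄) (hx₁ : 6 ≤ x₁)
    (h3 : ∀ x : ℝ, x₁ ≤ x →
      c₃ * Real.sqrt (x * Real.log x) ≤ (ramseyCountRow 3 x : ℝ) ∧
      (ramseyCountRow 3 x : ℝ) ≤ c₄ * Real.sqrt (x * Real.log x)) :
    ∃ x₂ : ℝ, 8 ≤ x₂ ∧ ∀ x : ℝ, max x₁ x₂ ≤ x →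
      c₃ * Real.sqrt (x * Real.log x) ≤ (ramseyCount x : ℝ) ∧
      (ramseyCount x : ℝ) ≤ c₄ * Real.sqrt (x * Real.log x) +
        2 * d ^ (-(9 : ℝ) / 4) * Real.logb 2 x * x ^ ((4 : ℝ) / 9) := by
  refine ⟨8, le_rfl, fun x hx => ?_⟩
  have hx8 : 8 ≤ x := (le_max_right _ _).trans hx
  have hx0 : 0 < x := by linarith
  obtain ⟨hlow, hup⟩ := h3 x ((le_max_left _ _).trans hx)
  refine ⟨hlow.trans ?_, ?_⟩
  · exact_mod_cast Set.ncard_le_ncard (RamseySetRow_subset_RamseySet le_rfl x) (finite_RamseySet x)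
  set K := ⌊2 * Real.logb 2 x⌋₊
  set M := ⌊(x / d) ^ ((4 : ℝ) / 9)⌋₊
  let T : Finset ℕ := (Finset.Icc 1 K ×ˢ Finset.Icc 1 M).image (Function.uncurry ramsey)
  have hlog : 0 ≤ Real.logb 2 x := Real.logb_nonneg (by norm_num) (by linarith)
  have hsub : RamseySet x ⊆ RamseySetRow 3 x ∪ (T : Set ℕ) := by
    rintro _ ⟨⟨k, n, hk, hkn, rfl⟩, hmx⟩
    rcases hk.eq_or_lt with rfl | hk
    · exact Or.inl ⟨⟨n, hkn, rfl⟩, hmx⟩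
    have hn : 0 < (n : ℝ) := by exact_mod_cast (show 0 < n by omega)
    have hdn := hr k n hk hkn
    have hpos : 0 < ramsey k n := by
      exact_mod_cast (show (0 : ℝ) < d * (n : ℝ) ^ ((9 : ℝ) / 4) by positivity).trans_le hdn
    refine Or.inr (Finset.mem_coe.2 (Finset.mem_image.2 ⟨(k, n), ?_, rfl⟩))
    refine Finset.mem_product.2 ⟨Finset.mem_Icc.2 ⟨by simp; omega, Nat.le_floor ?_⟩,
      Finset.mem_Icc.2 ⟨by simp; omega, Nat.le_floor ?_⟩⟩
    · have hsq : (2 : ℝ) ^ k ≤ x ^ 2 := by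
        calc (2 : ℝ) ^ k ≤ (ramsey k n : ℝ) ^ 2 := by
              exact_mod_cast two_pow_le_ramsey_sq hk hkn hpos
          _ ≤ x ^ 2 := by gcongr
      have := Real.logb_le_logb_of_le (b := 2) (by norm_num) (by positivity) hsq
      rw [Real.logb_pow, Real.logb_pow, Real.logb_self_eq_one (by norm_num), mul_one] at this
      exact_mod_cast this
    · have hnx : (n : ℝ) ^ ((9 : ℝ) / 4) ≤ x / d := by
        rw [le_div_iff₀ hd0]
        linarith
      calc (n : ℝ) = ((n : ℝ) ^ ((9 : ℝ) / 4)) ^ ((4 : ℝ) / 9) := by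
            rw [← Real.rpow_mul hn.le]
            norm_num
        _ ≤ _ := by gcongr
  have hrow : (RamseySetRow 3 x).Finite :=
    (finite_RamseySet x).subset (RamseySetRow_subset_RamseySet le_rfl x)
  have hcard : ramseyCount x ≤ ramseyCountRow 3 x + K * M := by
    calc ramseyCount x ≤ (RamseySetRow 3 x ∪ (T : Set ℕ)).ncard :=
          Set.ncard_le_ncard hsub (hrow.union T.finite_toSet)
      _ ≤ (RamseySetRow 3 x).ncard + (T : Set ℕ).ncard := Set.ncard_union_le _ _
      _ ≤ _ := by
          rw [Set.ncard_coe_finset]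
          refine Nat.add_le_add_left (Finset.card_image_le.trans ?_) _
          simp
  have hM : (M : ℝ) ≤ d ^ (-(9 : ℝ) / 4) * x ^ ((4 : ℝ) / 9) := by
    calc (M : ℝ) ≤ (x / d) ^ ((4 : ℝ) / 9) := Nat.floor_le (by positivity)
      _ = d ^ (-((4 : ℝ) / 9)) * x ^ ((4 : ℝ) / 9) := by
          rw [Real.div_rpow hx0.le hd0.le, Real.rpow_neg hd0.le, div_eq_inv_mul]
      _ ≤ _ := by
          gcongr ?_ * _
          exact Real.rpow_le_rpow_of_exponent_ge hd0 hd1 (by norm_num)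
  calc (ramseyCount x : ℝ) ≤ ramseyCountRow 3 x + K * M := by exact_mod_cast hcard
    _ ≤ c₄ * Real.sqrt (x * Real.log x) +
        (2 * Real.logb 2 x) * (d ^ (-(9 : ℝ) / 4) * x ^ ((4 : ℝ) / 9)) := by
        gcongr
        exact Nat.floor_le (by positivity)
    _ = _ := by ring
end
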